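/- arXiv:1811.01130 — 3 statements merged into one kernel-verified Lean document; each statement's English description precedes it below -/
import Mathlib

section
/- For all real x and σ, and all integers n ≥ 0 and k with 0 ≤ k ≤ 3n, the polynomials P_{n,k} satisfy the functional equation P_{n,k}(x, σ) = conj(P_{n,k}(−x, 1−σ)), where conj denotes complex conjugation. -/
open Complex Real MeasureTheory

noncomputable section

def chi (s : ℂ) : ℂ := (π : ℂ) ^ (s - 1/2) * Complex.Gamma ((1 - s)/2) / Complex.Gamma (s/2)

def RSOmega : Set ℂ := {s : ℂ | s.im ≠ 0 ∨ (0 < s.re ∧ s.re < 1)}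

def IsRSTheta (ϑ : ℂ → ℂ) : Prop :=
  DifferentiableOn ℂ ϑ RSOmega ∧ (∀ s ∈ RSOmega, Complex.exp (-2 * I * ϑ s) = chi s) ∧
    ϑ (1/2) = 0

def zetaSum (x : ℝ) (s : ℂ) : ℂ := ∑ n ∈ Finset.Icc 1 ⌊x⌋₊, (n : ℂ) ^ (-s)

def Upsilon (u τ : ℂ) : ℂ :=
  ∫ v : ℝ, Complex.exp (3 * (π:ℂ) * I / 4) *
    (Complex.exp (-(π:ℂ) * I * τ * (1/2 + Complex.exp (3 * (π:ℂ) * I / 4) * v) ^ 2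
        + 2 * (π:ℂ) * I * u * (1/2 + Complex.exp (3 * (π:ℂ) * I / 4) * v)) /
      (Complex.exp (2 * (π:ℂ) * I * (1/2 + Complex.exp (3 * (π:ℂ) * I / 4) * v)) - 1))

def G (u τ : ℂ) : ℂ :=
  τ ^ ((1:ℂ)/4) * Complex.exp (-(π:ℂ) * I * u ^ 2 / 2 + (π:ℂ) * I / 8) *
    Upsilon (τ ^ ((1:ℂ)/2) * u) τ

def Gderiv (k : ℕ) (u τ : ℂ) : ℂ := iteratedDeriv k (fun w => G w τ) u

def hermiteH (n : ℕ) (x : ℂ) : ℂ :=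
  (Nat.factorial n : ℂ) * ∑ j ∈ Finset.range (n / 2 + 1),
    (-1:ℂ) ^ j / ((Nat.factorial j : ℂ) * (Nat.factorial (n - 2*j) : ℂ)) * (2 * x) ^ (n - 2*j)

def obell (p : ℕ → ℂ) (i j : ℕ) : ℂ :=
  ∑ f ∈ (Finset.Nat.antidiagonalTuple j i).filter (fun f => ∀ l, 1 ≤ f l), ∏ l, p (f l)

def bernoulliPoly (n : ℕ) (x : ℂ) : ℂ := Polynomial.aeval x (Polynomial.bernoulli n)

def fseq (σ : ℝ) (n : ℕ) : ℂ :=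
  (bernoulliPoly (n+1) ((σ:ℂ)/2) + (-1:ℂ)^(n+1) * bernoulliPoly (n+1) ((1-(σ:ℂ))/2)) /
    (2*(n:ℂ)*((n:ℂ)+1))

def um (m : ℕ) (σ : ℝ) : ℂ :=
  (-2:ℂ)^m * ∑ k ∈ Finset.range (m+1), obell (fseq σ) m k / (Nat.factorial k : ℂ)

def seqA (j : ℕ) : ℂ := (-1:ℂ)^(j+1) / ((j:ℂ) + 2)

def seqB (j : ℕ) : ℂ := (-1:ℂ)^(j+1) / (j:ℂ)

def dd (m r : ℕ) (σ : ℝ) : ℂ :=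
  ∑ n ∈ Finset.Icc r m, (obell seqA n r / (Nat.factorial r : ℂ)) *
    ∑ k ∈ Finset.range (m - n + 1),
      (obell seqB (m - n) k / (Nat.factorial k : ℂ)) * ((σ:ℂ) - 1)^k

def qq (n ℓ : ℕ) (σ : ℝ) : ℂ :=
  ∑ m ∈ Finset.Icc (ℓ - n) (ℓ / 3), um m σ * dd (n - 2*m) (n + m - ℓ) σ

def PP (n k : ℕ) (x : ℂ) (σ : ℝ) : ℂ :=
  Complex.exp (3 * (π:ℂ) * I * (k:ℂ) / 4) * ∑ ℓ ∈ Finset.range (k/2 + 1),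
    (Nat.choose (3*n - 2*ℓ) (3*n - k) : ℂ) * (-1:ℂ)^(n + ℓ) * 2^(2*ℓ) / 2^k *
      qq n ℓ σ * hermiteH (k - 2*ℓ) (Complex.exp (-(π:ℂ) * I / 4) * x)

def IsAk (s : ℂ) (a : ℕ → ℂ) : Prop :=
  a 0 = 1 ∧ ∀ k : ℕ, ((k:ℂ) + 1) * (Real.sqrt s.im : ℂ) * a (k+1) =
    -((k:ℂ) + 1 - (s.re:ℂ)) * a k + I * (if 2 ≤ k then a (k-2) else 0)

def IsPsi (Ψ : ℂ → ℂ) : Prop :=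
  Differentiable ℂ Ψ ∧ ∀ u : ℂ, Complex.cos ((π:ℂ)*u) ≠ 0 →
    Ψ u = Complex.cos ((π:ℂ)*(u^2/2 - u - 1/8)) / Complex.cos ((π:ℂ)*u)

def wfun (s z : ℂ) : ℂ :=
  Complex.exp ((s - 1) * Complex.log (1 + z / (Real.sqrt s.im : ℂ))
    - I * (Real.sqrt s.im : ℂ) * z + I * z^2 / 2)

def rn (n : ℕ) (s z : ℂ) : ℂ :=
  wfun s z - ∑ k ∈ Finset.range n, (iteratedDeriv k (wfun s) 0 / (Nat.factorial k : ℂ)) * z^k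

def GammaOmega : Set ℂ := {s : ℂ | s.im ≠ 0 ∨ 0 < s.re}

def IsLogGamma (L : ℂ → ℂ) : Prop :=
  DifferentiableOn ℂ L GammaOmega ∧ (∀ s ∈ GammaOmega, Complex.exp (L s) = Complex.Gamma s) ∧
    L 1 = 0

def gseq (σ : ℝ) (n : ℕ) : ℂ := -(bernoulliPoly (n+1) (σ:ℂ)) / ((n:ℂ)*((n:ℂ)+1))

def gammam (m : ℕ) (σ : ℝ) : ℂ :=
  I^m * ∑ k ∈ Finset.range (m+1), obell (gseq σ) m k / (Nat.factorial k : ℂ)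

/-- power series without constant term attached to a sequence -/
def zser (p : ℕ → ℂ) : PowerSeries ℂ := PowerSeries.mk (fun n => if n = 0 then 0 else p n)

lemma zser_const (p : ℕ → ℂ) : PowerSeries.constantCoeff (zser p) = 0 := by
  simp [zser]

lemma tuple_sum_eq (q : ℕ → ℂ) (j : ℕ) : ∀ i : ℕ,
    ∑ f ∈ Finset.Nat.antidiagonalTuple j i, ∏ l, q (f l) =
      PowerSeries.coeff i ((PowerSeries.mk q) ^ j) := by
  induction j with
  | zero =>
    intro i
    cases i with
    | zero => simp
    | succ i => simp [PowerSeries.coeff_one]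
  | succ j ih =>
    intro i
    rw [pow_succ', PowerSeries.coeff_mul]
    simp_rw [← ih, Finset.mul_sum, PowerSeries.coeff_mk]
    rw [Finset.sum_sigma']
    refine Finset.sum_bij' (fun f _ => (⟨(f 0, ∑ l : Fin j, f l.succ), fun l => f l.succ⟩ :
        (_ : ℕ × ℕ) × (Fin j → ℕ)))
      (fun a _ => Fin.cons a.1.1 a.2) ?_ ?_ ?_ ?_ ?_
    · intro f hf
      rw [Finset.Nat.mem_antidiagonalTuple, Fin.sum_univ_succ] at hf
      simp [Finset.Nat.mem_antidiagonalTuple, hf]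
    · rintro ⟨⟨a, b⟩, g⟩ hg
      simp [Finset.Nat.mem_antidiagonalTuple] at hg
      simp [Finset.Nat.mem_antidiagonalTuple, Fin.sum_univ_succ, hg]
    · intro f hf
      ext l
      refine Fin.cases ?_ (fun l => ?_) l <;> simp
    · rintro ⟨⟨a, b⟩, g⟩ hg
      simp [Finset.Nat.mem_antidiagonalTuple] at hg
      simp [hg]
    · intro f hf
      rw [Fin.prod_univ_succ]

lemma obell_eq (p : ℕ → ℂ) (i j : ℕ) : obell p i j = PowerSeries.coeff i (zser p ^ j) := by
  unfold zser
  rw [← tuple_sum_eq, obell, Finset.sum_filter]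
  refine Finset.sum_congr rfl (fun f _ => ?_)
  split_ifs with h
  · refine Finset.prod_congr rfl (fun l _ => ?_)
    have := h l
    rw [if_neg (by omega)]
  · push Not at h
    obtain ⟨l, hl⟩ := h
    symm
    apply Finset.prod_eq_zero (Finset.mem_univ l)
    rw [if_pos (by omega)]

lemma coeff_pow_zero_of_lt {f : PowerSeries ℂ} (hf : PowerSeries.constantCoeff f = 0)
    {n k : ℕ} (h : n < k) : PowerSeries.coeff n (f ^ k) = 0 := by
  have h1 : PowerSeries.X ∣ f := PowerSeries.X_dvd_iff.mpr hf
  exact PowerSeries.X_pow_dvd_iff.mp (pow_dvd_pow_of_dvd h1 k) n h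

/-- truncated exponential sum -/
def texp (M : ℕ) (f : PowerSeries ℂ) : PowerSeries ℂ :=
  ∑ k ∈ Finset.range M, PowerSeries.C ((Nat.factorial k : ℂ)⁻¹) * f ^ k

def expS (f : PowerSeries ℂ) : PowerSeries ℂ :=
  PowerSeries.mk (fun n => ∑ k ∈ Finset.range (n+1), PowerSeries.coeff n (f ^ k) / (Nat.factorial k : ℂ))

lemma coeff_texp (M n : ℕ) (f : PowerSeries ℂ) : PowerSeries.coeff n (texp M f) =
    ∑ k ∈ Finset.range M, PowerSeries.coeff n (f ^ k) / (Nat.factorial k : ℂ) := by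
  unfold texp
  rw [map_sum]
  refine Finset.sum_congr rfl (fun k _ => ?_)
  rw [PowerSeries.coeff_C_mul, div_eq_mul_inv, mul_comm]

lemma coeff_expS {f : PowerSeries ℂ} (hf : PowerSeries.constantCoeff f = 0) {n M : ℕ} (h : n < M) :
    PowerSeries.coeff n (expS f) = PowerSeries.coeff n (texp M f) := by
  rw [coeff_texp, expS, PowerSeries.coeff_mk]
  refine Finset.sum_subset (by simpa using h) (fun k _ hk => ?_)
  rw [coeff_pow_zero_of_lt hf (by simpa using hk), zero_div]

lemma coeff_mul_expS {f : PowerSeries ℂ} (hf : PowerSeries.constantCoeff f = 0) (g : PowerSeries ℂ)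
    {n M : ℕ} (h : n < M) :
    PowerSeries.coeff n (g * expS f) = PowerSeries.coeff n (g * texp M f) := by
  rw [PowerSeries.coeff_mul, PowerSeries.coeff_mul]
  refine Finset.sum_congr rfl (fun a ha => ?_)
  rw [Finset.HasAntidiagonal.mem_antidiagonal] at ha
  rw [coeff_expS hf (show a.2 < M by omega)]

lemma coeff_zero_expS (f : PowerSeries ℂ) : PowerSeries.coeff 0 (expS f) = 1 := by
  simp [expS]

lemma deriv_texp (M : ℕ) (f : PowerSeries ℂ) :
    PowerSeries.derivative ℂ (texp (M+1) f) = PowerSeries.derivative ℂ f * texp M f := by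
  unfold texp
  rw [map_sum, Finset.sum_range_succ', Finset.mul_sum]
  simp only [Derivation.leibniz, PowerSeries.derivative_C, Derivation.leibniz_pow, smul_eq_mul]
  simp
  refine Finset.sum_congr rfl (fun k _ => ?_)
  have : (PowerSeries.C ((Nat.factorial (k+1) : ℂ)⁻¹)) * ((k:PowerSeries ℂ)+1) = PowerSeries.C ((Nat.factorial k : ℂ)⁻¹) := by
    have h2 : ((k:PowerSeries ℂ)+1) = PowerSeries.C ((k:ℂ)+1) := by simp
    rw [h2, ← map_mul, Nat.factorial_succ]
    congr 1
    push_cast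
    have : (k:ℂ)+1 ≠ 0 := by exact_mod_cast Nat.succ_ne_zero k
    have : (Nat.factorial k:ℂ) ≠ 0 := by exact_mod_cast Nat.factorial_ne_zero k
    field_simp
  rw [← this]
  ring

lemma deriv_expS {f : PowerSeries ℂ} (hf : PowerSeries.constantCoeff f = 0) :
    PowerSeries.derivative ℂ (expS f) = PowerSeries.derivative ℂ f * expS f := by
  ext n
  rw [coeff_mul_expS hf _ (show n < n+1 by omega), ← deriv_texp, PowerSeries.coeff_derivative,
    PowerSeries.coeff_derivative, coeff_expS hf (show n+1 < n+1+1 by omega)]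

lemma ode_unique {h P Q : PowerSeries ℂ} (hP : PowerSeries.derivative ℂ P = h * P)
    (hQ : PowerSeries.derivative ℂ Q = h * Q)
    (h0 : PowerSeries.coeff 0 P = PowerSeries.coeff 0 Q) : P = Q := by
  ext n
  induction n using Nat.strong_induction_on with
  | _ n ih =>
    cases n with
    | zero => exact h0
    | succ n =>
      have e1 := congrArg (PowerSeries.coeff n) hP
      have e2 := congrArg (PowerSeries.coeff n) hQ
      rw [PowerSeries.coeff_derivative, PowerSeries.coeff_mul] at e1 e2
      have hn : (n:ℂ)+1 ≠ 0 := by exact_mod_cast Nat.succ_ne_zero n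
      apply mul_right_cancel₀ hn
      rw [e1, e2]
      refine Finset.sum_congr rfl (fun a ha => ?_)
      rw [Finset.HasAntidiagonal.mem_antidiagonal] at ha
      rw [ih a.2 (by omega)]

lemma expS_add {f g : PowerSeries ℂ} (hf : PowerSeries.constantCoeff f = 0)
    (hg : PowerSeries.constantCoeff g = 0) : expS f * expS g = expS (f + g) := by
  apply ode_unique (h := PowerSeries.derivative ℂ (f + g))
  · rw [Derivation.leibniz, deriv_expS hf, deriv_expS hg, map_add]
    simp only [smul_eq_mul]
    ring
  · exact deriv_expS (by simp [hf, hg])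
  · have := coeff_zero_expS
    simp only [PowerSeries.coeff_zero_eq_constantCoeff, map_mul] at this ⊢
    simp [this]

/-- coefficientwise derivative in a parameter -/
def PD (f : ℝ → PowerSeries ℂ) (f' : PowerSeries ℂ) (s : ℝ) : Prop :=
  ∀ n, HasDerivAt (fun t => PowerSeries.coeff n (f t)) (PowerSeries.coeff n f') s

lemma PD.const (g : PowerSeries ℂ) (s : ℝ) : PD (fun _ => g) 0 s := by
  intro n
  simpa using hasDerivAt_const s (PowerSeries.coeff n g)

lemma PD.mul {f g : ℝ → PowerSeries ℂ} {f' g' : PowerSeries ℂ} {s : ℝ} (hf : PD f f' s)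
    (hg : PD g g' s) : PD (fun t => f t * g t) (f' * g s + f s * g') s := by
  intro n
  simp only [map_add, PowerSeries.coeff_mul]
  rw [← Finset.sum_add_distrib]
  exact HasDerivAt.fun_sum (fun a _ => (hf a.1).mul (hg a.2))

lemma PD.pow {f : ℝ → PowerSeries ℂ} {f' : PowerSeries ℂ} {s : ℝ} (hf : PD f f' s) (k : ℕ) :
    PD (fun t => f t ^ (k+1)) (((k+1 : ℕ) : PowerSeries ℂ) * f s ^ k * f') s := by
  induction k with
  | zero => simpa using hf
  | succ k ih =>
    have := ih.mul hf
    simp only [← pow_succ] at this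
    convert this using 1
    push_cast
    ring

lemma PD.expS {f : ℝ → PowerSeries ℂ} {f' : PowerSeries ℂ} {s : ℝ} (hf : PD f f' s)
    (h0 : ∀ t, PowerSeries.constantCoeff (f t) = 0) :
    PD (fun t => expS (f t)) (f' * expS (f s)) s := by
  intro n
  rw [coeff_mul_expS (h0 s) _ (show n < n+1 by omega)]
  have : (fun t => PowerSeries.coeff n (_root_.expS (f t))) =
      fun t => ∑ k ∈ Finset.range (n+1+1), PowerSeries.coeff n (f t ^ k) / (Nat.factorial k : ℂ) := by
    ext t
    rw [coeff_expS (h0 t) (show n < n+1+1 by omega), coeff_texp]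
  rw [this]
  have h2 : PowerSeries.coeff n (f' * texp (n+1) (f s)) = ∑ k ∈ Finset.range (n+1+1),
      (match k with
      | 0 => 0
      | (k+1) => PowerSeries.coeff n (((k+1 : ℕ) : PowerSeries ℂ) * f s ^ k * f') / (Nat.factorial (k+1) : ℂ)) := by
    rw [Finset.sum_range_succ']
    simp only [add_zero]
    unfold texp
    rw [Finset.mul_sum, map_sum]
    refine Finset.sum_congr rfl (fun k _ => ?_)
    have e1 : f' * (PowerSeries.C ((Nat.factorial k : ℂ)⁻¹) * f s ^ k) =
      PowerSeries.C ((Nat.factorial k : ℂ)⁻¹) * (f s ^ k * f') := by ring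
    have e2 : ((k+1 : ℕ) : PowerSeries ℂ) * f s ^ k * f' = PowerSeries.C ((k:ℂ)+1) * (f s ^ k * f') := by
      simp; ring
    rw [e1, e2, PowerSeries.coeff_C_mul, PowerSeries.coeff_C_mul, Nat.factorial_succ]
    push_cast
    have : (k:ℂ)+1 ≠ 0 := by exact_mod_cast Nat.succ_ne_zero k
    have : (Nat.factorial k:ℂ) ≠ 0 := by exact_mod_cast Nat.factorial_ne_zero k
    field_simp
  rw [h2]
  refine HasDerivAt.fun_sum (fun k _ => ?_)
  cases k with
  | zero => simpa using hasDerivAt_const s _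
  | succ k => exact ((hf.pow k) n).div_const _

def lamB (s : ℝ) : PowerSeries ℂ := PowerSeries.C ((s:ℂ) - 1) * zser seqB

lemma lamB_const (s : ℝ) : PowerSeries.constantCoeff (lamB s) = 0 := by
  simp [lamB, zser_const]

def Dser (r : ℕ) (s : ℝ) : PowerSeries ℂ :=
  PowerSeries.C ((Nat.factorial r : ℂ)⁻¹) * zser seqA ^ r * expS (lamB s)

lemma dd_eq (m r : ℕ) (s : ℝ) : dd m r s = PowerSeries.coeff m (Dser r s) := by
  unfold Dser dd
  rw [mul_assoc, PowerSeries.coeff_C_mul, PowerSeries.coeff_mul,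
    Finset.Nat.sum_antidiagonal_eq_sum_range_succ_mk, Finset.mul_sum]
  have hsub : Finset.Icc r m ⊆ Finset.range (m.succ) := by
    intro x hx
    simp at hx ⊢
    omega
  rw [← Finset.sum_subset hsub]
  · refine Finset.sum_congr rfl (fun n _ => ?_)
    rw [obell_eq, expS, PowerSeries.coeff_mk]
    have : ∑ k ∈ Finset.range (m - n + 1),
      (obell seqB (m - n) k / (Nat.factorial k : ℂ)) * ((s:ℂ) - 1)^k =
      ∑ k ∈ Finset.range (m - n + 1), PowerSeries.coeff (m - n) (lamB s ^ k) / (Nat.factorial k : ℂ) := by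
      refine Finset.sum_congr rfl (fun k _ => ?_)
      rw [obell_eq, lamB, mul_pow, ← map_pow, PowerSeries.coeff_C_mul]
      ring
    rw [this]
    ring
  · intro n h1 h2
    simp at h1 h2
    rw [coeff_pow_zero_of_lt (zser_const _) (by omega)]
    simp

lemma dd_zero_of_lt {m r : ℕ} (h : m < r) (s : ℝ) : dd m r s = 0 := by
  unfold dd
  rw [Finset.Icc_eq_empty (by omega)]
  simp

lemma dd_zero_zero (s : ℝ) : dd 0 0 s = 1 := by
  rw [dd_eq, Dser]
  simp
  have := coeff_zero_expS (lamB s)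
  simpa using this

lemma B_deriv : (1 + PowerSeries.X) * PowerSeries.derivative ℂ (zser seqB) = 1 := by
  ext n
  rw [add_mul, one_mul, map_add]
  cases n with
  | zero => simp [PowerSeries.coeff_derivative, zser, seqB]
  | succ n =>
    rw [PowerSeries.coeff_succ_X_mul, PowerSeries.coeff_derivative, PowerSeries.coeff_derivative]
    simp only [zser, seqB, PowerSeries.coeff_mk]
    have h1 : (n:ℂ)+1 ≠ 0 := by exact_mod_cast Nat.succ_ne_zero n
    have h2 : (n:ℂ)+1+1 ≠ 0 := by exact_mod_cast Nat.succ_ne_zero (n+1)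
    simp [PowerSeries.coeff_one]
    field_simp
    ring

lemma B_eq : zser seqB = PowerSeries.X ^ 2 * zser seqA + PowerSeries.X
    - PowerSeries.C (1/2 : ℂ) * PowerSeries.X ^ 2 := by
  ext n
  match n with
  | 0 => simp [zser]
  | 1 => 
    have e : PowerSeries.coeff 1 (PowerSeries.X ^ 2 * zser seqA) = 0 := by
      rw [PowerSeries.coeff_X_pow_mul']
      simp
    rw [map_sub, map_add, e]
    simp [zser, seqB, PowerSeries.coeff_X_pow]
  | (n+2) =>
    rw [map_sub, map_add, PowerSeries.coeff_C_mul, PowerSeries.coeff_X_pow, PowerSeries.coeff_X,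
      add_comm n 2, ← pow_one (PowerSeries.X ^ 2 : PowerSeries ℂ), ← pow_mul]
    rw [PowerSeries.coeff_X_pow_mul']
    simp only [zser, seqB, seqA, PowerSeries.coeff_mk]
    have h2 : (2:ℂ)+n ≠ 0 := by exact_mod_cast (by omega : 2 + n ≠ 0)
    have h3 : (n:ℂ)+2 ≠ 0 := by exact_mod_cast (by omega : n+2 ≠ 0)
    rcases Nat.eq_zero_or_pos n with h | h
    · subst h
      simp
      norm_num
    · have hn : n ≠ 0 := by omega
      simp [hn]
      rw [if_neg (by omega)]
      field_simp
      ring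

lemma A_deriv : (1 + PowerSeries.X) * (PowerSeries.X * PowerSeries.derivative ℂ (zser seqA) +
    2 * zser seqA) = PowerSeries.X := by
  have h := congrArg (PowerSeries.derivative ℂ) B_eq
  have h2 := B_deriv
  simp only [map_sub, map_add, Derivation.leibniz, Derivation.leibniz_pow, PowerSeries.derivative_C,
    PowerSeries.derivative_X, smul_eq_mul] at h
  rw [h] at h2
  have hc : (PowerSeries.C (1/2 : ℂ)) * 2 = 1 := by
    have : (2 : PowerSeries ℂ) = PowerSeries.C 2 := (map_ofNat (PowerSeries.C (R := ℂ)) 2).symm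
    rw [this, ← map_mul]
    simp
  apply mul_left_cancel₀ (PowerSeries.X_ne_zero (R := ℂ))
  simp at h2
  simp at hc
  linear_combination h2 + (PowerSeries.X + PowerSeries.X^2) * hc

lemma lamB_deriv (s : ℝ) : (1 + PowerSeries.X) * PowerSeries.derivative ℂ (lamB s) =
    PowerSeries.C ((s:ℂ) - 1) := by
  have h2 := B_deriv
  unfold lamB
  rw [Derivation.leibniz, PowerSeries.derivative_C]
  simp only [smul_eq_mul]
  linear_combination PowerSeries.C ((s:ℂ) - 1) * h2

lemma fact_C (r : ℕ) : PowerSeries.C ((Nat.factorial (r+1) : ℂ)⁻¹) * ((r:PowerSeries ℂ)+1) =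
    PowerSeries.C ((Nat.factorial r : ℂ)⁻¹) := by
  have h2 : ((r:PowerSeries ℂ)+1) = PowerSeries.C ((r:ℂ)+1) := by simp
  rw [h2, ← map_mul, Nat.factorial_succ]
  congr 1
  push_cast
  have : (r:ℂ)+1 ≠ 0 := by exact_mod_cast Nat.succ_ne_zero r
  have : (Nat.factorial r:ℂ) ≠ 0 := by exact_mod_cast Nat.factorial_ne_zero r
  field_simp

lemma A_mul_Dser (r : ℕ) (s : ℝ) : zser seqA * Dser r s = ((r:PowerSeries ℂ)+1) * Dser (r+1) s := by
  unfold Dser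
  rw [← fact_C r]
  ring

lemma Dser_ode (r : ℕ) (s : ℝ) :
    (1 + PowerSeries.X) * (PowerSeries.X * PowerSeries.derivative ℂ (Dser (r+1) s) +
      (2 * ((r:PowerSeries ℂ)+1)) * Dser (r+1) s) = PowerSeries.X * Dser r s +
      PowerSeries.X * (PowerSeries.C ((s:ℂ) - 1) * Dser (r+1) s) := by
  have h1 := A_deriv
  have h2 := lamB_deriv s
  unfold Dser
  rw [← fact_C r]
  simp only [Derivation.leibniz, Derivation.leibniz_pow, PowerSeries.derivative_C,
    deriv_expS (lamB_const s), smul_eq_mul]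
  simp at h2 ⊢
  linear_combination (PowerSeries.C ((Nat.factorial (r+1) : ℂ)⁻¹) * ((r:PowerSeries ℂ)+1) *
    zser seqA ^ r * expS (lamB s)) * h1 + (PowerSeries.X *
    PowerSeries.C ((Nat.factorial (r+1) : ℂ)⁻¹) * zser seqA ^ (r+1) * expS (lamB s)) * h2

lemma Dser_ode0 (s : ℝ) :
    (1 + PowerSeries.X) * (PowerSeries.X * PowerSeries.derivative ℂ (Dser 0 s)) = 
      PowerSeries.X * (PowerSeries.C ((s:ℂ) - 1) * Dser 0 s) := by
  have h2 := lamB_deriv s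
  unfold Dser
  simp [deriv_expS (lamB_const s)] at h2 ⊢
  linear_combination (PowerSeries.X * expS (lamB s)) * h2

lemma coeff_X_deriv (m : ℕ) (f : PowerSeries ℂ) :
    PowerSeries.coeff m (PowerSeries.X * PowerSeries.derivative ℂ f) = m * PowerSeries.coeff m f := by
  cases m with
  | zero => simp
  | succ m =>
    rw [PowerSeries.coeff_succ_X_mul, PowerSeries.coeff_derivative]
    push_cast
    ring

lemma coeff_nat_mul (m : ℕ) (c : ℕ) (f : PowerSeries ℂ) :
    PowerSeries.coeff m ((c : PowerSeries ℂ) * f) = c * PowerSeries.coeff m f := by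
  have : (c : PowerSeries ℂ) = PowerSeries.C (c:ℂ) := by simp
  rw [this, PowerSeries.coeff_C_mul]

lemma dd_rec (m r : ℕ) (s : ℝ) :
    ((m:ℂ) + 1 + 2 * (r+1)) * dd (m+1) (r+1) s + ((m:ℂ) + 2 * (r+1)) * dd m (r+1) s =
      dd m r s + ((s:ℂ) - 1) * dd m (r+1) s := by
  have h := congrArg (PowerSeries.coeff (m+1)) (Dser_ode r s)
  have e : (2 * ((r:PowerSeries ℂ)+1)) = ((2*(r+1) : ℕ) : PowerSeries ℂ) := by push_cast; ring
  rw [e, add_mul, one_mul, map_add, map_add, coeff_X_deriv, PowerSeries.coeff_succ_X_mul, map_add,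
    coeff_X_deriv, coeff_nat_mul, coeff_nat_mul, map_add,
    PowerSeries.coeff_succ_X_mul, PowerSeries.coeff_succ_X_mul, PowerSeries.coeff_C_mul] at h
  simp only [← dd_eq] at h
  push_cast at h
  linear_combination h

lemma dd_rec0 (m : ℕ) (s : ℝ) :
    ((m:ℂ) + 1) * dd (m+1) 0 s + (m:ℂ) * dd m 0 s = ((s:ℂ) - 1) * dd m 0 s := by
  have h := congrArg (PowerSeries.coeff (m+1)) (Dser_ode0 s)
  rw [add_mul, one_mul, map_add, coeff_X_deriv, PowerSeries.coeff_succ_X_mul,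
    coeff_X_deriv,
    PowerSeries.coeff_succ_X_mul, PowerSeries.coeff_C_mul] at h
  simp only [← dd_eq] at h
  push_cast at h
  linear_combination h

lemma PD_lamB (s : ℝ) : PD lamB (zser seqB) s := by
  intro n
  unfold lamB
  simp only [PowerSeries.coeff_C_mul]
  have h : HasDerivAt (fun t : ℝ => (t:ℂ) - 1) 1 s := by
    simpa using (Complex.ofRealCLM.hasDerivAt (x := s)).sub_const 1
  simpa using h.mul_const (PowerSeries.coeff n (zser seqB))

lemma PD_Dser (r : ℕ) (s : ℝ) : PD (Dser r) (zser seqB * Dser r s) s := by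
  have := (PD.const (PowerSeries.C ((Nat.factorial r : ℂ)⁻¹) * zser seqA ^ r) s).mul
    ((PD_lamB s).expS lamB_const)
  unfold Dser
  convert this using 1
  ring

lemma BD_eq (r : ℕ) (s : ℝ) : zser seqB * Dser r s = PowerSeries.X *(PowerSeries.X * 
    (((r+1 : ℕ):PowerSeries ℂ) * Dser (r+1) s)) + PowerSeries.X * Dser r s
    - PowerSeries.X * (PowerSeries.X * (PowerSeries.C (1/2 : ℂ) * Dser r s)) := by
  have h := A_mul_Dser r s
  rw [B_eq]
  push_cast
  linear_combination PowerSeries.X^2 * h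

lemma dd_d0 (r : ℕ) (s : ℝ) : HasDerivAt (dd 0 r) 0 s := by
  have h := PD_Dser r s 0
  simp only [← dd_eq] at h
  rw [BD_eq] at h
  simpa using h

lemma dd_d1 (r : ℕ) (s : ℝ) : HasDerivAt (dd 1 r) (dd 0 r s) s := by
  have h := PD_Dser r s (0+1)
  simp only [← dd_eq] at h
  rw [BD_eq, map_sub, map_add, PowerSeries.coeff_succ_X_mul, PowerSeries.coeff_succ_X_mul,
    PowerSeries.coeff_succ_X_mul, ← dd_eq] at h
  simpa using h

lemma dd_d2 (m r : ℕ) (s : ℝ) : HasDerivAt (dd (m+2) r)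
    (((r:ℂ)+1) * dd m (r+1) s + dd (m+1) r s - 1/2 * dd m r s) s := by
  have h := PD_Dser r s (m+1+1)
  simp only [← dd_eq] at h
  rw [BD_eq, map_sub, map_add, PowerSeries.coeff_succ_X_mul, PowerSeries.coeff_succ_X_mul,
    PowerSeries.coeff_succ_X_mul, PowerSeries.coeff_succ_X_mul, PowerSeries.coeff_succ_X_mul,
    coeff_nat_mul, PowerSeries.coeff_C_mul, ← dd_eq, ← dd_eq, ← dd_eq] at h
  push_cast at h
  exact h

lemma expS_shift : expS (lamB 1) = (1 + PowerSeries.X) * expS (lamB 0) := by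
  have h1 := lamB_deriv 1
  have h0 := lamB_deriv 0
  have hl : lamB 1 = 0 := by simp [lamB]
  apply ode_unique (h := 0)
  · rw [deriv_expS (lamB_const 1), hl]; simp
  · rw [Derivation.leibniz, deriv_expS (lamB_const 0)]
    simp at h0 ⊢
    linear_combination expS (lamB 0) * h0
  · have := coeff_zero_expS
    simp only [PowerSeries.coeff_zero_eq_constantCoeff, map_mul] at this ⊢
    simp [this]

lemma dd_shift (m r : ℕ) : dd (m+1) r 1 = dd (m+1) r 0 + dd m r 0 := by
  have : Dser r 1 = Dser r 0 + PowerSeries.X * Dser r 0 := by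
    unfold Dser
    rw [expS_shift]
    ring
  rw [dd_eq, this, map_add, PowerSeries.coeff_succ_X_mul, dd_eq, dd_eq]

def TT (a : ℂ) : Polynomial ℂ →ₗ[ℂ] Polynomial ℂ :=
  (LinearMap.applyₗ (1 : Polynomial ℂ)) ∘ₗ
    (Polynomial.aeval (R := ℂ) (A := Module.End ℂ (Polynomial ℂ)) (LinearMap.mulLeft ℂ (Polynomial.X : Polynomial ℂ) +
      a • Polynomial.derivative)).toLinearMap

lemma TT_one (a : ℂ) : TT a 1 = 1 := by
  simp [TT]

lemma TT_X_mul (a : ℂ) (p : Polynomial ℂ) :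
    TT a (Polynomial.X * p) = Polynomial.X * TT a p + a • Polynomial.derivative (TT a p) := by
  simp [TT]

lemma poly_ind {φ ψ : Polynomial ℂ →ₗ[ℂ] Polynomial ℂ} (h1 : φ 1 = ψ 1)
    (hs : ∀ p, φ p = ψ p → φ (Polynomial.X * p) = ψ (Polynomial.X * p)) (p : Polynomial ℂ) :
    φ p = ψ p := by
  induction p using Polynomial.induction_on' with
  | add p q hp hq => rw [map_add, map_add, hp, hq]
  | monomial n c =>
    have : Polynomial.monomial n c = c • (Polynomial.X ^ n : Polynomial ℂ) := by
      rw [← Polynomial.C_mul_X_pow_eq_monomial, Polynomial.smul_eq_C_mul]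
    rw [this, map_smul, map_smul]
    congr 1
    induction n with
    | zero => simpa using h1
    | succ n ih => 
      rw [pow_succ']
      apply hs
      apply ih
      rw [← Polynomial.C_mul_X_pow_eq_monomial, Polynomial.smul_eq_C_mul]

lemma TT_deriv (a : ℂ) (p : Polynomial ℂ) :
    TT a (Polynomial.derivative p) = Polynomial.derivative (TT a p) := by
  refine poly_ind (φ := TT a ∘ₗ Polynomial.derivative) (ψ := Polynomial.derivative ∘ₗ TT a) ?_ ?_ p
  · simp [TT_one]
  · intro p hp
    simp only [LinearMap.comp_apply] at hp ⊢
    rw [Polynomial.derivative_mul, map_add, TT_X_mul, TT_X_mul, hp]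
    simp [add_assoc]

lemma TT_comp (a b : ℂ) (p : Polynomial ℂ) : TT a (TT b p) = TT (a + b) p := by
  refine poly_ind (φ := TT a ∘ₗ TT b) (ψ := TT (a+b)) ?_ ?_ p
  · simp [TT_one]
  · intro p hp
    simp only [LinearMap.comp_apply] at hp ⊢
    rw [TT_X_mul, map_add, TT_X_mul, map_smul, TT_deriv, hp, TT_X_mul]
    module

def WW (κ : ℂ) (n : ℕ) (s : ℝ) : Polynomial ℂ :=
  ∑ r ∈ Finset.range (n+1), (κ ^ r * dd n r s) • (Polynomial.X : Polynomial ℂ) ^ (n + 2 * r)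

lemma WW_eq (κ : ℂ) (n M : ℕ) (h : n < M) (s : ℝ) : WW κ n s =
    ∑ r ∈ Finset.range M, (κ ^ r * dd n r s) • (Polynomial.X : Polynomial ℂ) ^ (n + 2 * r) := by
  unfold WW
  refine Finset.sum_subset (by simpa using h) (fun k _ hk => ?_)
  rw [dd_zero_of_lt (by simpa using hk)]
  simp

lemma WW_zero (κ : ℂ) (s : ℝ) : WW κ 0 s = 1 := by
  simp [WW, dd_zero_zero]

lemma X_mul_deriv (k : ℕ) : Polynomial.X * Polynomial.derivative ((Polynomial.X : Polynomial ℂ) ^ k) =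
    (k : ℂ) • Polynomial.X ^ k := by
  cases k with
  | zero => simp
  | succ k =>
    rw [Polynomial.derivative_X_pow, Polynomial.smul_eq_C_mul]
    simp
    ring

lemma WW_rec (κ : ℂ) (n : ℕ) (s : ℝ) :
    Polynomial.derivative (WW κ (n+1) s) + Polynomial.X * Polynomial.derivative (WW κ n s) =
      ((s:ℂ) - 1) • WW κ n s + κ • (Polynomial.X ^ 2 * WW κ n s) := by
  have e1 : Polynomial.derivative (WW κ (n+1) s) = ∑ r ∈ Finset.range (n+2),
      (κ ^ r * dd (n+1) r s * ((n:ℂ) + 1 + 2 * r)) • (Polynomial.X : Polynomial ℂ) ^ (n + 2 * r) := by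
    rw [WW, map_sum]
    refine Finset.sum_congr rfl (fun r _ => ?_)
    rw [map_smul, Polynomial.derivative_X_pow, mul_smul _ ((n:ℂ) + 1 + 2 * r)]
    congr 1
    rw [show n + 1 + 2 * r - 1 = n + 2 * r by omega, Polynomial.smul_eq_C_mul]
    push_cast
    rfl
  have e2 : Polynomial.X * Polynomial.derivative (WW κ n s) = ∑ r ∈ Finset.range (n+2),
      (κ ^ r * dd n r s * ((n:ℂ) + 2 * r)) • (Polynomial.X : Polynomial ℂ) ^ (n + 2 * r) := by
    rw [WW_eq κ n (n+2) (by omega), map_sum, Finset.mul_sum]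
    refine Finset.sum_congr rfl (fun r _ => ?_)
    rw [map_smul, mul_smul_comm, X_mul_deriv, smul_smul]
    push_cast
    rfl
  have e3 : κ • (Polynomial.X ^ 2 * WW κ n s) = ∑ r ∈ Finset.range (n+1),
      (κ ^ (r+1) * dd n r s) • (Polynomial.X : Polynomial ℂ) ^ (n + 2 * (r+1)) := by
    rw [WW, Finset.mul_sum, Finset.smul_sum]
    refine Finset.sum_congr rfl (fun r _ => ?_)
    rw [mul_smul_comm, smul_smul, ← pow_add]
    congr 1
    · ring
    · ring
  rw [e1, e2, e3, WW_eq κ n (n+2) (by omega), ← Finset.sum_add_distrib, Finset.smul_sum,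
    Finset.sum_range_succ', Finset.sum_range_succ' _ (n+1), add_right_comm (∑ k ∈ Finset.range (n+1), ((s:ℂ) - 1) • _), ← Finset.sum_add_distrib]
  congr 1
  · refine Finset.sum_congr rfl (fun r _ => ?_)
    rw [smul_smul, ← add_smul, ← add_smul]
    congr 1
    have := dd_rec n r s
    push_cast
    linear_combination κ^(r+1) * this
  · rw [smul_smul, ← add_smul]
    congr 1
    have := dd_rec0 n s
    push_cast
    linear_combination this

lemma WW_shift (κ : ℂ) (n : ℕ) : WW κ (n+1) 1 = WW κ (n+1) 0 + Polynomial.X * WW κ n 0 := by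
  rw [WW_eq κ n (n+2) (by omega), WW, WW, Finset.mul_sum, ← Finset.sum_add_distrib]
  refine Finset.sum_congr rfl (fun r _ => ?_)
  rw [mul_smul_comm, ← pow_succ', show n + 2*r+1 = n+1+2*r by ring, ← add_smul, dd_shift]
  congr 1
  ring

lemma WW_hasDeriv (κ : ℂ) (n : ℕ) (s : ℝ) (φ : Polynomial ℂ →ₗ[ℂ] ℂ) (d' : ℕ → ℂ)
    (h : ∀ r, HasDerivAt (dd n r) (d' r) s) : HasDerivAt (fun t => φ (WW κ n t))
    (φ (∑ r ∈ Finset.range (n+1), (κ ^ r * d' r) • (Polynomial.X : Polynomial ℂ) ^ (n + 2 * r))) s := by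
  unfold WW
  simp only [map_sum, map_smul, smul_eq_mul]
  exact HasDerivAt.fun_sum (fun r _ => ((h r).const_mul _).mul_const _)

lemma WW_d1 (κ : ℂ) (s : ℝ) (φ : Polynomial ℂ →ₗ[ℂ] ℂ) : HasDerivAt (fun t => φ (WW κ 1 t))
    (φ Polynomial.X) s := by
  have := WW_hasDeriv κ 1 s φ _ (fun r => dd_d1 r s)
  convert this using 2
  simp [Finset.sum_range_succ, dd_zero_zero, dd_zero_of_lt]

lemma WW_d2 (κ : ℂ) (hκ : κ ^ 2 = -1) (n : ℕ) (s : ℝ) (φ : Polynomial ℂ →ₗ[ℂ] ℂ) :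
    HasDerivAt (fun t => φ (WW κ (n+2) t))
    (φ ((-κ/2) • (Polynomial.X * Polynomial.derivative (WW κ n s)) + (κ * n / 2) • WW κ n s
      + Polynomial.X * WW κ (n+1) s - (1/2 : ℂ) • (Polynomial.X ^ 2 * WW κ n s))) s := by
  have := WW_hasDeriv κ (n+2) s φ _ (fun r => dd_d2 n r s)
  convert this using 2
  have e2 : (-κ/2) • (Polynomial.X * Polynomial.derivative (WW κ n s)) + (κ * n / 2) • WW κ n s = 
      ∑ r ∈ Finset.range (n+3),
      (κ ^ r * ((r+1) * dd n (r+1) s)) • (Polynomial.X : Polynomial ℂ) ^ (n + 2 + 2 * r) := by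
    rw [WW_eq κ n (n+4) (by omega), map_sum, Finset.mul_sum, Finset.smul_sum, Finset.smul_sum,
      ← Finset.sum_add_distrib, Finset.sum_range_succ']
    have z : ∀ a b : Polynomial ℂ, b = 0 → a + b = a := by intro a b h; rw [h, add_zero]
    rw [z]
    · refine Finset.sum_congr rfl (fun r _ => ?_)
      rw [map_smul, mul_smul_comm, X_mul_deriv, smul_smul, smul_smul, smul_smul, ← add_smul,
        show n + 2 * (r+1) = n + 2 + 2 * r by ring]
      congr 1
      push_cast
      linear_combination (- κ ^ r * (r+1) * dd n (r+1) s) * hκ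
    · rw [map_smul, mul_smul_comm, X_mul_deriv, smul_smul, smul_smul, smul_smul, ← add_smul]
      push_cast
      convert zero_smul ℂ _
      ring
  rw [e2, WW_eq κ n (n+3) (by omega), WW_eq κ (n+1) (n+3) (by omega), Finset.mul_sum, Finset.mul_sum,
    Finset.smul_sum, ← Finset.sum_add_distrib, ← Finset.sum_sub_distrib]
  refine Finset.sum_congr rfl (fun r _ => ?_)
  rw [mul_smul_comm, mul_smul_comm, ← pow_succ', ← pow_add, show n + 1 + 2 * r + 1 = n + 2 + 2 * r by ring,
    show 2 + (n + 2 * r) = n + 2 + 2 * r by ring]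
  module

/-- value at zero of the transform -/
def cc (n : ℕ) (s : ℝ) : ℂ := (TT I (WW (-I) n s)).eval 0

def phi0 : Polynomial ℂ →ₗ[ℂ] ℂ := (Polynomial.leval 0) ∘ₗ TT I

lemma cc_eq (n : ℕ) (s : ℝ) : cc n s = phi0 (WW (-I) n s) := rfl

lemma F_rec (n : ℕ) (s : ℝ) : Polynomial.derivative (TT I (WW (-I) (n+1) s)) =
    Polynomial.X * Polynomial.derivative (TT I (WW (-I) n s)) + (s:ℂ) • TT I (WW (-I) n s)
     - I • (Polynomial.X ^ 2 * TT I (WW (-I) n s)) := by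
  have h := congrArg (TT I) (WW_rec (-I) n s)
  rw [map_add, map_add, map_smul, map_smul, pow_two, mul_assoc, TT_X_mul, TT_X_mul, TT_X_mul, TT_deriv, TT_deriv] at h
  simp only [Polynomial.derivative_add, Polynomial.derivative_mul, Polynomial.derivative_X,
    Polynomial.derivative_smul, smul_add, mul_add, one_mul, smul_smul, mul_smul_comm] at h
  have hI : (-I * I : ℂ) = 1 := by simp
  have hI2 : (-I * (I*I) : ℂ) = I := by simp
  simp only [hI, hI2, one_smul] at h
  simp only [Polynomial.smul_eq_C_mul, map_sub, map_neg, map_one] at h ⊢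
  linear_combination h

lemma F_deriv_zero (n : ℕ) (s : ℝ) :
    (Polynomial.derivative (TT I (WW (-I) (n+1) s))).eval 0 = s * cc n s := by
  rw [F_rec]
  simp [cc]

lemma phi0_X_mul (p : Polynomial ℂ) : phi0 (Polynomial.X * p) =
    I * (Polynomial.derivative (TT I p)).eval 0 := by
  simp [phi0, TT_X_mul]

lemma cc_zero (s : ℝ) : cc 0 s = 1 := by
  simp [cc, WW_zero, TT_one]

lemma cc_d1 (s : ℝ) : HasDerivAt (cc 1) 0 s := by
  have := WW_d1 (-I) s phi0
  refine HasDerivAt.congr_deriv this ?_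
  rw [← mul_one Polynomial.X, phi0_X_mul, TT_one]
  simp

lemma cc_d2 (n : ℕ) (s : ℝ) : HasDerivAt (cc (n+2)) (I * ((s:ℂ) - 1/2 - n/2) * cc n s) s := by
  have := WW_d2 (-I) (by simp) n s phi0
  refine HasDerivAt.congr_deriv this ?_
  rw [map_sub, map_add, map_add, map_smul, map_smul, map_smul, phi0_X_mul, phi0_X_mul, pow_two, mul_assoc,
    phi0_X_mul, F_deriv_zero, TT_X_mul, TT_deriv, ← cc_eq]
  simp only [smul_eq_mul, Polynomial.derivative_add, Polynomial.derivative_mul, Polynomial.derivative_X,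
    Polynomial.derivative_smul]
  simp
  rw [show (TT I (WW (-I) n s)).eval 0 = cc n s from rfl]
  generalize Polynomial.eval 0 _ = y
  ring_nf

lemma cc_per (n : ℕ) : cc n 1 = cc n 0 := by
  cases n with
  | zero => rw [cc_zero, cc_zero]
  | succ n =>
    rw [cc_eq, WW_shift, map_add, ← cc_eq, phi0_X_mul]
    cases n with
    | zero => simp [WW_zero, TT_one]
    | succ n => rw [F_deriv_zero]; simp

def sseq (s : ℝ) (n : ℕ) : ℂ :=
  (-1:ℂ)^(n+1) * (bernoulliFun (n+1) s : ℂ) / ((n:ℂ) * ((n:ℂ)+1))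

def ee (n : ℕ) (s : ℝ) : ℂ := PowerSeries.coeff n (expS (zser (sseq s)))

lemma bern_deriv (k : ℕ) (s : ℝ) : HasDerivAt (fun t : ℝ => (bernoulliFun (k+1) t : ℂ))
    (((k:ℂ)+1) * (bernoulliFun k s : ℂ)) s := by
  have := (hasDerivAt_bernoulliFun (k+1) s).ofReal_comp
  simpa using this

lemma PD_sseq (s : ℝ) : PD (fun t => zser (sseq t)) (PowerSeries.X * (PowerSeries.C ((s:ℂ) - 1/2) -
    PowerSeries.X * PowerSeries.derivative ℂ (zser (sseq s)))) s := by
  intro n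
  cases n with
  | zero => simpa [zser] using hasDerivAt_const s (0:ℂ)
  | succ n =>
    rw [PowerSeries.coeff_succ_X_mul, map_sub, coeff_X_deriv]
    simp only [zser, PowerSeries.coeff_mk, sseq]
    have h := ((bern_deriv (n+1) s).const_mul ((-1:ℂ)^(n+1+1))).div_const (((n+1:ℕ):ℂ) * (((n+1:ℕ):ℂ)+1))
    have h1 : (n:ℂ)+1 ≠ 0 := by exact_mod_cast Nat.succ_ne_zero n
    have h2 : (n:ℂ)+1+1 ≠ 0 := by exact_mod_cast Nat.succ_ne_zero (n+1)
    simp only [Nat.succ_ne_zero, if_false]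
    refine HasDerivAt.congr_deriv h ?_
    rcases Nat.eq_zero_or_pos n with hn | hn
    · subst hn
      simp
    · have hn' : (n:ℂ) ≠ 0 := by exact_mod_cast (by omega : n ≠ 0)
      rw [PowerSeries.coeff_C, if_neg (by omega), if_neg (by omega)]
      push_cast
      field_simp
      ring

lemma ee_d0 (s : ℝ) : ee 0 s = 1 := coeff_zero_expS _

lemma ee_d (n : ℕ) (s : ℝ) : HasDerivAt (ee (n+1)) (((s:ℂ) - 1/2 - n) * ee n s) s := by
  have h := (PD_sseq s).expS (fun t => zser_const _) (n+1)
  refine HasDerivAt.congr_deriv h ?_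
  have : PowerSeries.X * (PowerSeries.C ((s:ℂ) - 1/2) -
    PowerSeries.X * PowerSeries.derivative ℂ (zser (sseq s))) * expS (zser (sseq s)) =
    PowerSeries.X * (PowerSeries.C ((s:ℂ) - 1/2) * expS (zser (sseq s)) -
    PowerSeries.X * PowerSeries.derivative ℂ (expS (zser (sseq s)))) := by
    rw [deriv_expS (zser_const _)]
    ring
  rw [this, PowerSeries.coeff_succ_X_mul, map_sub, coeff_X_deriv, PowerSeries.coeff_C_mul, ← ee]
  ring

lemma ee_per (n : ℕ) : ee n 1 = ee n 0 := by
  have : zser (sseq 1) = zser (sseq 0) := by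
    ext k
    simp only [zser, PowerSeries.coeff_mk]
    split_ifs with h
    · rfl
    · rw [sseq, sseq, bernoulliFun_endpoints_eq_of_ne_one (by omega)]
  rw [ee, ee, this]

lemma const_of_deriv {f : ℝ → ℂ} (h : ∀ s, HasDerivAt f 0 s) (s : ℝ) : f s = f 0 :=
  is_const_of_deriv_eq_zero (fun x => (h x).differentiableAt) (fun x => (h x).deriv) s 0

lemma uniq_zero (d : ℕ → ℝ → ℂ) (h0 : ∀ s, d 0 s = 0) (h1 : ∀ s, HasDerivAt (d 1) 0 s)
    (h2 : ∀ (n : ℕ) (s : ℝ), HasDerivAt (d (n+2)) (I * ((s:ℂ) - 1/2 - n/2) * d n s) s)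
    (hp : ∀ n, d n 1 = d n 0) : ∀ n s, d n s = 0 := by
  have key : ∀ n, 1 ≤ n → (∀ s, HasDerivAt (d n) 0 s) → ∀ s, d n s = 0 := by
    intro n hn hd
    have hc := const_of_deriv hd
    have hid : ∀ s : ℝ, HasDerivAt (fun t : ℝ => (t:ℂ)) 1 s := fun s => by
      simpa using (hasDerivAt_id s).ofReal_comp
    have hg : ∀ s, HasDerivAt (fun t => d (n+2) t - I * d n 0 * ((t:ℂ)^2/2 - (1/2 + n/2) * t)) 0 s := by
      intro s
      have e := (h2 n s).sub (((((hid s).pow 2).div_const 2).sub ((hid s).const_mul (1/2 + n/2:ℂ))).const_mul (I * d n 0))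
      refine HasDerivAt.congr_deriv e ?_
      rw [hc s]
      push_cast
      ring
    have h3 := const_of_deriv hg 1
    rw [hp (n+2)] at h3
    have hn' : (n:ℂ) ≠ 0 := by exact_mod_cast (by omega : n ≠ 0)
    have h4 : I * n * d n 0 = 0 := by
      push_cast at h3
      linear_combination 2 * h3
    have h5 : d n 0 = 0 := by
      simpa [hn'] using h4
    intro s
    rw [hc s, h5]
  intro n
  induction n using Nat.strong_induction_on with
  | _ n ih =>
    match n with
    | 0 => exact h0
    | 1 => exact key 1 le_rfl h1
    | (n+2) =>
      apply key (n+2) (by omega)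
      intro s
      have := h2 n s
      rw [ih n (by omega) s, mul_zero] at this
      exact this

def aa (n : ℕ) (s : ℝ) : ℂ := if n % 2 = 0 then I ^ (n/2) * ee (n/2) s else 0

lemma cc_eq_aa (n : ℕ) (s : ℝ) : cc n s = aa n s := by
  have := uniq_zero (fun (n : ℕ) (s : ℝ) => cc n s - aa n s) ?_ ?_ ?_ ?_ n s
  · linear_combination this
  · intro s
    simp [cc_zero, aa, ee_d0]
  · intro s
    have : aa 1 = fun _ => 0 := by ext t; simp [aa]
    simpa [this] using cc_d1 s
  · intro n s
    have : HasDerivAt (aa (n+2)) (I * ((s:ℂ) - 1/2 - n/2) * aa n s) s := by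
      unfold aa
      have e1 : (n+2) % 2 = n % 2 := by omega
      have e2 : (n+2)/2 = n/2+1 := by omega
      simp only [e1, e2]
      split_ifs with h
      · refine HasDerivAt.congr_deriv ((ee_d (n/2) s).const_mul _) ?_
        have : ((n/2 : ℕ) : ℂ) = (n:ℂ)/2 := by
          rw [Nat.cast_div (by omega) (by norm_num)]; simp
        rw [this]
        ring
      · simpa using hasDerivAt_const s (0:ℂ)
    refine HasDerivAt.congr_deriv ((cc_d2 n s).sub this) ?_
    ring
  · intro n
    rw [cc_per]
    have : aa n 1 = aa n 0 := by
      unfold aa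
      rw [ee_per]
    rw [this]

def VV (n : ℕ) (s : ℝ) : Polynomial ℂ := (-1:ℂ)^n • WW I n (1 - s)

lemma VV_zero (s : ℝ) : VV 0 s = 1 := by simp [VV, WW_zero]

lemma VV_eval (n : ℕ) (s : ℝ) : (VV (n+1) s).eval 0 = 0 := by
  simp [VV, WW, Polynomial.eval_finsetSum]

lemma VV_rec (n : ℕ) (s : ℝ) : Polynomial.derivative (VV (n+1) s) =
    Polynomial.X * Polynomial.derivative (VV n s) + (s:ℂ) • VV n s
     - I • (Polynomial.X ^ 2 * VV n s) := by
  have h := WW_rec I n (1 - s)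
  unfold VV
  simp only [Polynomial.derivative_smul, mul_smul_comm]
  push_cast at h
  simp only [Polynomial.smul_eq_C_mul, map_sub, map_neg, map_one, map_pow] at h ⊢
  linear_combination (-1)^(n+1) * h

lemma F_eq (n : ℕ) (s : ℝ) : TT I (WW (-I) n s) =
    ∑ j ∈ Finset.range (n/2+1), (I^j * ee j s) • VV (n - 2*j) s := by
  induction n with
  | zero => simp [WW_zero, TT_one, VV_zero, ee_d0]
  | succ n ih =>
    have hd : Polynomial.derivative (TT I (WW (-I) (n+1) s)) = Polynomial.derivative
        (∑ j ∈ Finset.range ((n+1)/2+1), (I^j * ee j s) • VV (n + 1 - 2*j) s) := by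
      rw [F_rec, ih, map_sum, map_sum, Finset.mul_sum, Finset.mul_sum, Finset.smul_sum, Finset.smul_sum,
        ← Finset.sum_add_distrib, ← Finset.sum_sub_distrib]
      have hs : Finset.range (n/2+1) ⊆ Finset.range ((n+1)/2+1) := by
        intro x hx
        simp at hx ⊢
        omega
      rw [← Finset.sum_subset hs]
      · refine Finset.sum_congr rfl (fun j hj => ?_)
        simp at hj
        rw [show n + 1 - 2*j = (n - 2*j) + 1 by omega, map_smul, map_smul, VV_rec]
        simp only [Polynomial.smul_eq_C_mul]
        ring
      · intro j h1 h2
        simp at h1 h2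
        rw [show n + 1 - 2*j = 0 by omega, VV_zero]
        simp
    have h0 : (TT I (WW (-I) (n+1) s)).eval 0 = 
        (∑ j ∈ Finset.range ((n+1)/2+1), (I^j * ee j s) • VV (n + 1 - 2*j) s).eval 0 := by
      rw [show (TT I (WW (-I) (n+1) s)).eval 0 = cc (n+1) s from rfl, cc_eq_aa, Polynomial.eval_finsetSum,
        Finset.sum_range_succ, Finset.sum_eq_zero]
      · rw [zero_add, aa]
        split_ifs with h
        · rw [show n + 1 - 2 * ((n+1)/2) = 0 by omega, VV_zero]
          simp
        · rw [show n + 1 - 2 * ((n+1)/2) = 0 + 1 by omega, Polynomial.eval_smul, VV_eval]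
          simp
      · intro j hj
        simp at hj
        rw [show n + 1 - 2 * j = (n - 2*j) + 1 by omega, Polynomial.eval_smul, VV_eval]
        simp
    have hz := Polynomial.derivative_eq_zero.mp
      (show Polynomial.derivative ( TT I (WW (-I) (n+1) s) - (∑ j ∈ Finset.range ((n+1)/2+1), (I^j * ee j s) • VV (n + 1 - 2*j) s)) = 0
      by rw [Polynomial.derivative_sub, hd, sub_self])
    rw [← sub_eq_zero]
    rw [Polynomial.eq_C_of_natDegree_eq_zero hz, Polynomial.coeff_zero_eq_eval_zero,
      Polynomial.eval_sub, h0, sub_self, map_zero]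

lemma scal_expS (c : ℂ) (p : ℕ → ℂ) (m : ℕ) :
    c^m * ∑ k ∈ Finset.range (m+1), obell p m k / (Nat.factorial k : ℂ) =
      PowerSeries.coeff m (expS (zser (fun n => c^n * p n))) := by
  have : zser (fun n => c^n * p n) = PowerSeries.rescale c (zser p) := by
    ext n
    simp [zser, PowerSeries.coeff_rescale]
  rw [expS, PowerSeries.coeff_mk, this, Finset.mul_sum]
  refine Finset.sum_congr rfl (fun k _ => ?_)
  rw [← map_pow, PowerSeries.coeff_rescale, obell_eq]
  ring

lemma bernPoly_eq (n : ℕ) (x : ℝ) : bernoulliPoly n (x:ℂ) = (bernoulliFun n x : ℂ) := by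
  rw [bernoulliPoly, bernoulliFun, Polynomial.eval_map_algebraMap]
  exact (Polynomial.aeval_algebraMap_apply ℂ x _)

def freal (s : ℝ) (n : ℕ) : ℝ :=
  (bernoulliFun (n+1) (s/2) + (-1)^(n+1) * bernoulliFun (n+1) ((1-s)/2)) / (2*(n:ℝ)*((n:ℝ)+1))

lemma fseq_eq (s : ℝ) (n : ℕ) : fseq s n = (freal s n : ℂ) := by
  have h1 := bernPoly_eq (n+1) (s/2)
  have h2 := bernPoly_eq (n+1) ((1-s)/2)
  push_cast at h1 h2
  rw [fseq, h1, h2, freal]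
  push_cast
  rfl

lemma fseq_rel (s : ℝ) (n : ℕ) (hn : n ≠ 0) :
    (-2:ℂ)^n * fseq s n + sseq s n = 2^n * fseq (1 - s) n := by
  have hm := bernoulliFun_mul (n+1) (m := 2) (by norm_num) (s/2)
  have hr := bernoulliFun_eval_one_sub (k := n+1) (x := (1-s)/2)
  rw [show 1 - (1-s)/2 = s/2 + 1/2 by ring] at hr
  simp [Finset.sum_range_succ] at hm
  rw [show 2 * (s/2) = s by ring, show (s/2 + 2⁻¹) = s/2 + 1/2 by norm_num, hr] at hm
  rw [fseq_eq, fseq_eq, sseq, hm, freal, freal]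
  have h1 : (n:ℂ)+1 ≠ 0 := by exact_mod_cast Nat.succ_ne_zero n
  have hn' : (n:ℂ) ≠ 0 := by exact_mod_cast hn
  have hneg : (-2:ℂ)^n = (-1)^n * 2^n := by rw [← mul_pow]; norm_num
  rw [hneg, show 1 - (1 - s) = s by ring]
  push_cast
  have hs : ((-1:ℂ)^n)^2 = 1 := by rw [← pow_mul, mul_comm, pow_mul]; simp
  field_simp
  ring_nf
  simp only [hs, pow_mul]
  try ring_nf
  try simp only [hs]
  try ring

lemma um_rel (s : ℝ) (N : ℕ) : (-1:ℂ)^N * um N (1 - s) =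
    ∑ m ∈ Finset.range (N+1), um m s * ee (N - m) s := by
  have e1 : (-1:ℂ)^N * um N (1 - s) = PowerSeries.coeff N (expS (zser (fun n => 2^n * fseq (1-s) n))) := by
    rw [← scal_expS, um, ← mul_assoc, ← mul_pow]
    norm_num
  have e2 : zser (fun n => 2^n * fseq (1-s) n) = zser (fun n => (-2)^n * fseq s n) + zser (sseq s) := by
    ext n
    simp only [zser, PowerSeries.coeff_mk, map_add]
    split_ifs with h
    · simp
    · rw [fseq_rel s n h]
  rw [e1, e2, ← expS_add (zser_const _) (zser_const _), PowerSeries.coeff_mul,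
    Finset.Nat.sum_antidiagonal_eq_sum_range_succ_mk]
  refine Finset.sum_congr rfl (fun m _ => ?_)
  rw [um, scal_expS, ee]

def QQ (ι : ℂ) (n : ℕ) (s : ℝ) : Polynomial ℂ :=
  ∑ m ∈ Finset.range (n/2+1), (ι^m * um m s) • WW (-ι) (n - 2*m) s

lemma QQ_rel (n : ℕ) (s : ℝ) : TT I (QQ I n s) = (-1:ℂ)^n • QQ (-I) n (1 - s) := by
  have e1 : TT I (QQ I n s) = ∑ m ∈ Finset.range (n/2+1), ∑ j ∈ Finset.range (n/2+1-m),
      (I^(m+j) * (um m s * ee j s)) • VV (n - 2*(m+j)) s := by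
    rw [QQ, map_sum]
    refine Finset.sum_congr rfl (fun m hm => ?_)
    simp at hm
    rw [map_smul, F_eq, Finset.smul_sum, show (n - 2*m)/2+1 = n/2+1-m by omega]
    refine Finset.sum_congr rfl (fun j _ => ?_)
    rw [smul_smul, show n - 2*m - 2*j = n - 2*(m+j) by omega]
    congr 1
    ring
  rw [e1, ← Finset.sum_range_diag_flip (n/2+1) (fun m j => (I^(m+j) * (um m s * ee j s)) • VV (n - 2*(m+j)) s),
    QQ, Finset.smul_sum]
  refine Finset.sum_congr rfl (fun N hN => ?_)
  simp at hN
  have : ∀ k ∈ Finset.range (N+1), (I^(k+(N-k)) * (um k s * ee (N-k) s)) • VV (n - 2*(k+(N-k))) s =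
      (I^N * (um k s * ee (N-k) s)) • VV (n - 2*N) s := by
    intro k hk
    simp at hk
    rw [show k + (N-k) = N by omega]
  rw [Finset.sum_congr rfl this, ← Finset.sum_smul, ← Finset.mul_sum, ← um_rel, VV, smul_smul, smul_smul,
    neg_neg]
  congr 1
  obtain ⟨j, rfl⟩ : ∃ j, n = j + 2*N := ⟨n - 2*N, by omega⟩
  rw [show j + 2*N - 2*N = j by omega, pow_add, pow_mul, neg_pow I]
  simp
  ring

def he (a : ℂ) (j : ℕ) (z : ℂ) : ℂ := (TT a (Polynomial.X ^ j)).eval z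

lemma he_zero (a z : ℂ) : he a 0 z = 1 := by simp [he, TT_one]

lemma he_one (a z : ℂ) : he a 1 z = z := by
  rw [he, pow_one, ← mul_one Polynomial.X, TT_X_mul]
  simp [TT_one]

lemma he_rec (a z : ℂ) (j : ℕ) : he a (j+2) z = z * he a (j+1) z + a * (j+1) * he a j z := by
  unfold he
  rw [pow_succ' _ (j+1), TT_X_mul, ← TT_deriv, Polynomial.derivative_X_pow, ← Polynomial.smul_eq_C_mul,
    map_smul]
  simp
  ring

lemma he_conj (a z : ℂ) (j : ℕ) : starRingEnd ℂ (he a j z) =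
    he (starRingEnd ℂ a) j (starRingEnd ℂ z) := by
  induction j using Nat.strong_induction_on with
  | _ j ih =>
    match j with
    | 0 => simp [he_zero]
    | 1 => simp [he_one]
    | (j+2) =>
      rw [he_rec, he_rec, map_add, map_mul, map_mul, map_mul, ih j (by omega), ih (j+1) (by omega)]
      simp

def ht (n j : ℕ) (y : ℂ) : ℂ := if 2*j ≤ n then
  (-1:ℂ) ^ j / ((Nat.factorial j : ℂ) * (Nat.factorial (n - 2*j) : ℂ)) * y ^ (n - 2*j) else 0

lemma hermiteH_eq (n M : ℕ) (h : n/2 < M) (x : ℂ) : hermiteH n x =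
    (Nat.factorial n : ℂ) * ∑ j ∈ Finset.range M, ht n j (2*x) := by
  unfold hermiteH
  congr 1
  have hs : Finset.range (n/2+1) ⊆ Finset.range M := by
    intro y hy
    simp at hy ⊢
    omega
  rw [← Finset.sum_subset hs]
  · refine Finset.sum_congr rfl (fun j hj => ?_)
    simp at hj
    rw [ht, if_pos (by omega)]
  · intro j h1 h2
    simp at h1 h2
    rw [ht, if_neg (by omega)]

lemma fne (n : ℕ) : (Nat.factorial n : ℂ) ≠ 0 := by exact_mod_cast Nat.factorial_ne_zero n
lemma sne (n : ℕ) : (n : ℂ) + 1 ≠ 0 := by exact_mod_cast Nat.succ_ne_zero n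

lemma ht_rec (n j : ℕ) (y : ℂ) : ((n:ℂ)+2) * ht (n+2) (j+1) y = y * ht (n+1) (j+1) y - 2 * ht n j y := by
  unfold ht
  rcases lt_trichotomy (2*j) n with h | h | h
  · obtain ⟨q, rfl⟩ : ∃ q, n = q + 2*j + 1 := ⟨n - 2*j - 1, by omega⟩
    rw [if_pos (by omega), if_pos (by omega), if_pos (by omega),
      show q + 2*j+1+2 - 2*(j+1) = q+1 by omega, show q + 2*j+1+1 - 2*(j+1) = q by omega,
      show q + 2*j+1 - 2*j = q+1 by omega, Nat.factorial_succ, Nat.factorial_succ]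
    push_cast
    have := fne q
    have := fne j
    have := sne q
    have := sne j
    field_simp
    ring
  · subst h
    rw [if_pos (by omega), if_neg (by omega), if_pos (by omega), 
      show 2*j+2-2*(j+1) = 0 by omega, Nat.factorial_succ]
    push_cast
    have := fne j
    have := sne j
    simp
    field_simp
    ring
  · rw [if_neg (by omega), if_neg (by omega), if_neg (by omega)]
    simp

lemma ht_rec0 (n : ℕ) (y : ℂ) : ((n:ℂ)+2) * ht (n+2) 0 y = y * ht (n+1) 0 y := by
  unfold ht
  simp [Nat.factorial_succ]
  have := fne n
  have := sne n
  have h2 : (n:ℂ)+1+1 ≠ 0 := by exact_mod_cast Nat.succ_ne_zero (n+1)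
  field_simp
  ring

lemma hermiteH_rec (n : ℕ) (x : ℂ) : hermiteH (n+2) x =
    2 * x * hermiteH (n+1) x - 2 * (n+1) * hermiteH n x := by
  rw [hermiteH_eq (n+2) (n+4) (by omega), hermiteH_eq (n+1) (n+4) (by omega),
    hermiteH_eq n (n+3) (by omega)]
  have key : ((n:ℂ)+2) * ∑ j ∈ Finset.range (n+4), ht (n+2) j (2*x) =
    (2*x) * ∑ j ∈ Finset.range (n+4), ht (n+1) j (2*x) - 2 * ∑ j ∈ Finset.range (n+3), ht n j (2*x) := by
    rw [Finset.sum_range_succ', Finset.sum_range_succ' _ (n+3), mul_add, mul_add, ht_rec0, Finset.mul_sum,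
      Finset.mul_sum, Finset.mul_sum, add_sub_right_comm, ← Finset.sum_sub_distrib]
    congr 1
    exact Finset.sum_congr rfl (fun j _ => ht_rec n j _)
  rw [Nat.factorial_succ (n+1), Nat.factorial_succ n]
  push_cast
  linear_combination (((n:ℂ)+1) * (Nat.factorial n : ℂ)) * key

def ww : ℂ := Complex.exp (3 * (π:ℂ) * I / 4)

lemma ww_sq : ww ^ 2 = -I := by
  rw [ww, ← Complex.exp_nat_mul, show ((2:ℕ):ℂ) * (3 * (π:ℂ) * I / 4) = (π:ℂ) * I + (π:ℂ)/2 * I by push_cast; ring,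
    Complex.exp_add, Complex.exp_pi_mul_I, Complex.exp_pi_div_two_mul_I]
  ring

lemma ww_mul : ww * Complex.exp (-(π:ℂ) * I / 4) = I := by
  rw [ww, ← Complex.exp_add, show 3 * (π:ℂ) * I / 4 + -(π:ℂ) * I / 4 = (π:ℂ)/2 * I by ring,
    Complex.exp_pi_div_two_mul_I]

lemma herm_he (x : ℂ) (j : ℕ) : (ww/2)^j * hermiteH j (Complex.exp (-(π:ℂ) * I / 4) * x) =
    he (I/2) j (I * x) := by
  induction j using Nat.strong_induction_on with
  | _ j ih =>
    match j with
    | 0 => simp [he_zero, hermiteH]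
    | 1 =>
      simp [he_one, hermiteH]
      have := ww_mul
      simp at this
      linear_combination x * this
    | (j+2) =>
      rw [he_rec, hermiteH_rec, ← ih j (by omega), ← ih (j+1) (by omega)]
      generalize hermiteH j _ = A
      generalize hermiteH (j+1) _ = B
      have h1 := ww_mul
      have h2 := ww_sq
      linear_combination ((ww/2)^(j+1) * x * B) * h1 - (1/2*(ww/2)^j * (j+1) * A) * h2

lemma PP_eq (n k : ℕ) (x : ℂ) (s : ℝ) : PP n k x s = (-1:ℂ)^n * ∑ ℓ ∈ Finset.range (k/2 + 1),
    (Nat.choose (3*n - 2*ℓ) (3*n - k) : ℂ) * I^ℓ * qq n ℓ s * he (I/2) (k - 2*ℓ) (I * x) := by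
  have hw : Complex.exp (3 * (π:ℂ) * I * (k:ℂ) / 4) = ww ^ k := by
    rw [ww, ← Complex.exp_nat_mul]
    congr 1
    ring
  rw [PP, hw, Finset.mul_sum, Finset.mul_sum]
  refine Finset.sum_congr rfl (fun l hl => ?_)
  simp only [Finset.mem_range] at hl
  rw [← herm_he]
  obtain ⟨j, rfl⟩ : ∃ j, k = 2*l + j := ⟨k - 2*l, by omega⟩
  rw [show 2*l+j-2*l = j by omega]
  generalize hermiteH j _ = A
  generalize Nat.choose _ _ = c
  have h3 : ww^(2*l+j) = (-1)^l * I^l * ww^j := by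
    rw [pow_add, pow_mul, ww_sq, neg_pow]
  have h4 : ((-1:ℂ)^l)^2 = 1 := by rw [← pow_mul, mul_comm, pow_mul]; simp
  have h5 : (2:ℂ)^(2*l) ≠ 0 := pow_ne_zero _ two_ne_zero
  rw [h3, div_pow, pow_add (2:ℂ), pow_add (-1:ℂ)]
  have h6 : (2:ℂ)^j ≠ 0 := pow_ne_zero _ two_ne_zero
  field_simp
  linear_combination (ww^j * c * qq n l s * A) * h4

lemma TT_iter (a : ℂ) (j : ℕ) (p : Polynomial ℂ) :
    TT a (Polynomial.derivative^[j] p) = Polynomial.derivative^[j] (TT a p) := by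
  induction j with
  | zero => rfl
  | succ j ih => rw [Function.iterate_succ_apply', Function.iterate_succ_apply', TT_deriv, ih]

lemma TT_hasse (a : ℂ) (j : ℕ) (p : Polynomial ℂ) :
    Polynomial.hasseDeriv j (TT a p) = TT a (Polynomial.hasseDeriv j p) := by
  have h1 := congrFun (Polynomial.factorial_smul_hasseDeriv (R := ℂ) j) p
  have h2 := congrFun (Polynomial.factorial_smul_hasseDeriv (R := ℂ) j) (TT a p)
  rw [← TT_iter, ← h1] at h2
  simp only [LinearMap.smul_apply, Pi.smul_apply, map_nsmul] at h2
  exact smul_right_injective _ (Nat.factorial_ne_zero j) h2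

lemma hasse_X_pow (a z : ℂ) (j N : ℕ) :
    (Polynomial.hasseDeriv j (TT a (Polynomial.X ^ N))).eval z = (Nat.choose N j : ℂ) * he a (N - j) z := by
  rw [TT_hasse, ← Polynomial.monomial_one_right_eq_X_pow, Polynomial.hasseDeriv_monomial, mul_one,
    ← Polynomial.C_mul_X_pow_eq_monomial, ← Polynomial.smul_eq_C_mul, map_smul, Polynomial.eval_smul, he,
    smul_eq_mul]

lemma QQ_expand (ι : ℂ) (hι : ι ^ 2 = -1) (n : ℕ) (s : ℝ) : ι^n • QQ ι n s =
    ∑ ℓ ∈ Finset.range (3*n/2+1), (ι^ℓ * qq n ℓ s) • (Polynomial.X : Polynomial ℂ)^(3*n - 2*ℓ) := by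
  unfold QQ qq WW
  simp only [Finset.smul_sum, Finset.mul_sum, Finset.sum_smul]
  rw [Finset.sum_sigma', Finset.sum_sigma']
  refine Finset.sum_bij' (fun a _ => (⟨n + a.1 - a.2, a.1⟩ : (_ : ℕ) × ℕ))
    (fun a _ => (⟨a.2, n + a.2 - a.1⟩ : (_ : ℕ) × ℕ)) ?_ ?_ ?_ ?_ ?_
  · rintro ⟨m, r⟩ h
    simp at h ⊢
    omega
  · rintro ⟨l, m⟩ h
    simp at h ⊢
    omega
  · rintro ⟨m, r⟩ h
    simp at h ⊢
    omega
  · rintro ⟨l, m⟩ h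
    simp at h ⊢
    omega
  · rintro ⟨m, r⟩ h
    simp at h ⊢
    rw [smul_smul, smul_smul, show 3*n - 2*(n+m-r) = n - 2*m + 2*r by omega,
      show n + m - (n+m-r) = r by omega]
    congr 1
    obtain ⟨q, hq⟩ : ∃ q, n + m = q + r := ⟨n+m-r, by omega⟩
    rw [hq, show q + r - r = q by omega]
    have e1 : ι^n * ι^m = ι^q * ι^r := by rw [← pow_add, hq, pow_add]
    have e2 : ι^r * (-ι)^r = 1 := by
      rw [← mul_pow, show ι * -ι = 1 by linear_combination -hι, one_pow]
    linear_combination (um m s * (-ι)^r * dd (n-2*m) r s) * e1 + (ι^q * um m s * dd (n-2*m) r s) * e2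

lemma S_eq (ι a z : ℂ) (hι : ι ^ 2 = -1) (n k : ℕ) (hk : k ≤ 3*n) (s : ℝ) :
    ∑ ℓ ∈ Finset.range (k/2 + 1),
      (Nat.choose (3*n - 2*ℓ) (3*n - k) : ℂ) * ι^ℓ * qq n ℓ s * he a (k - 2*ℓ) z =
    ι^n * (Polynomial.hasseDeriv (3*n-k) (TT a (QQ ι n s))).eval z := by
  rw [← smul_eq_mul (a := ι^n), ← Polynomial.eval_smul, ← map_smul, ← map_smul, QQ_expand ι hι, map_sum, map_sum,
    Polynomial.eval_finsetSum]
  have hs : Finset.range (k/2+1) ⊆ Finset.range (3*n/2+1) := by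
    intro y hy
    simp at hy ⊢
    omega
  rw [← Finset.sum_subset hs]
  · refine Finset.sum_congr rfl (fun l hl => ?_)
    simp at hl
    rw [map_smul, map_smul, Polynomial.eval_smul, hasse_X_pow, show 3*n-2*l-(3*n-k) = k - 2*l by omega,
      smul_eq_mul]
    ring
  · intro l h1 h2
    simp at h1 h2
    rw [map_smul, map_smul, Polynomial.eval_smul, hasse_X_pow, Nat.choose_eq_zero_of_lt (by omega)]
    simp

lemma conj_two : starRingEnd ℂ 2 = 2 := map_ofNat _ 2

lemma obell_conj (p : ℕ → ℂ) (hp : ∀ n, starRingEnd ℂ (p n) = p n) (i j : ℕ) :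
    starRingEnd ℂ (obell p i j) = obell p i j := by
  simp [obell, map_sum, map_prod, hp]

lemma dd_conj (m r : ℕ) (s : ℝ) : starRingEnd ℂ (dd m r s) = dd m r s := by
  have hA : ∀ n, starRingEnd ℂ (seqA n) = seqA n := by intro n; simp [seqA, conj_two]
  have hB : ∀ n, starRingEnd ℂ (seqB n) = seqB n := by intro n; simp [seqB]
  simp [dd, map_sum, obell_conj _ hA, obell_conj _ hB]

lemma um_conj (m : ℕ) (s : ℝ) : starRingEnd ℂ (um m s) = um m s := by
  have hA : ∀ n, starRingEnd ℂ (fseq s n) = fseq s n := by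
    intro n
    rw [fseq_eq, Complex.conj_ofReal]
  simp [um, map_sum, conj_two, obell_conj _ hA]

lemma qq_conj (n l : ℕ) (s : ℝ) : starRingEnd ℂ (qq n l s) = qq n l s := by
  simp [qq, map_sum, dd_conj, um_conj]

theorem statement6 (x σ : ℝ) (n k : ℕ) (hk : k ≤ 3 * n) :
    PP n k (x : ℂ) σ = starRingEnd ℂ (PP n k ((-x : ℝ) : ℂ) (1 - σ)) := by
  have h2 : starRingEnd ℂ (PP n k ((-x : ℝ) : ℂ) (1 - σ)) =
      (-1:ℂ)^n * ∑ ℓ ∈ Finset.range (k/2 + 1), (Nat.choose (3*n - 2*ℓ) (3*n - k) : ℂ) * (-I)^ℓ *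
        qq n ℓ (1 - σ) * he (-I/2) (k - 2*ℓ) (I * x) := by
    rw [PP_eq, map_mul, map_sum]
    congr 1
    · simp
    · refine Finset.sum_congr rfl (fun l _ => ?_)
      rw [map_mul, map_mul, map_mul, he_conj, qq_conj]
      simp [conj_two]
  rw [h2, PP_eq, S_eq I _ _ (by simp) n k hk, S_eq (-I) _ _ (by simp) n k hk]
  have h3 : QQ (-I) n (1 - σ) = (-1:ℂ)^n • TT I (QQ I n σ) := by
    rw [QQ_rel, smul_smul, ← mul_pow]
    simp
  rw [h3, map_smul, TT_comp, map_smul, Polynomial.eval_smul, smul_eq_mul,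
    show -I/2 + I = I/2 by ring, neg_pow I]
  have h4 : ((-1:ℂ)^n)^2 = 1 := by rw [← pow_mul, mul_comm, pow_mul]; simp
  generalize Polynomial.eval (I * (x:ℂ)) _ = y
  linear_combination (- (-1)^n * I^n * y) * h4

end
end

section
/- For all u, τ ∈ ℂ with Re(τ) > 0 and all integers m, n ≥ 0, the Mordell integral satisfies: (i) Υ(u + m; τ) = Υ(u; τ) + e^{3πi/4}·τ^{−1/2}·Σ_{j=0}^{m−1} e^{πi(j+u)²/τ}, and (ii) Υ(u + nτ; τ) = e^{πin(nτ + 2u)}·Υ(u; τ) − e^{πi(nτ+u)²/τ}·Σ_{j=0}^{n−1} e^{−πi(jτ+u)²/τ}, where τ^{−1/2} is the principal branch. -/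
open Complex Real MeasureTheory

noncomputable section

/-! ### Helper material -/

/-- half of sqrt 2 -/
def sS : ℝ := Real.sqrt 2 / 2

lemma sS_pos : 0 < sS := by unfold sS; positivity

lemma sS_sq : sS * sS = 1 / 2 := by
  unfold sS
  have := Real.mul_self_sqrt (show (0:ℝ) ≤ 2 by norm_num)
  nlinarith

lemma sS_le : sS ≤ 1 := by
  have := sS_sq; have := sS_pos
  nlinarith

lemma sS_ge : 1 / 2 ≤ sS := by
  have := sS_sq; have := sS_pos
  nlinarith

/-- the direction -/
def oM : ℂ := ⟨-sS, sS⟩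

lemma oM_eq : Complex.exp (3 * (π:ℂ) * I / 4) = oM := by
  have h : 3 * (π:ℂ) * I / 4 = ((π - π / 4 : ℝ) : ℂ) * I := by push_cast; ring
  rw [h, Complex.exp_mul_I, ← Complex.ofReal_cos, ← Complex.ofReal_sin, Real.cos_pi_sub,
    Real.sin_pi_sub, Real.cos_pi_div_four, Real.sin_pi_div_four]
  apply Complex.ext <;> simp [oM, sS]

lemma oM_sq : oM ^ 2 = -I := by
  have := sS_sq
  rw [pow_two]
  apply Complex.ext <;> simp [oM] <;> linarith

lemma oM_conj : oM * (-(sS / 2 : ℝ) - (sS / 2 : ℝ) * I) = 1 / 2 := by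
  have := sS_sq
  apply Complex.ext <;> simp [oM] <;> nlinarith

/-- numerator -/
def eN (u τ w : ℂ) : ℂ := Complex.exp (-(π:ℂ) * τ * w ^ 2 + 2 * π * I * u * oM * w)

/-- denominator -/
def dN (w : ℂ) : ℂ := Complex.exp (2 * π * I * (oM * w)) - 1

lemma eN_bound (u τ : ℂ) (hτ : 0 < τ.re) : ∃ C : ℝ, ∀ x y : ℝ, |y| ≤ 1 →
    ‖eN u τ (x + y * I)‖ ≤ C * Real.exp (-(π * τ.re / 2) * x ^ 2) := by
  set c : ℂ := 2 * π * I * u * oM with hc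
  set B : ℝ := 2 * π * |τ.im| + |c.re| with hB
  have hp := Real.pi_pos
  have hk : 0 < π * τ.re := by positivity
  refine ⟨Real.exp (π * τ.re + |c.im| + B ^ 2 / (2 * (π * τ.re))), fun x y hy => ?_⟩
  rw [eN, Complex.norm_exp, ← Real.exp_add]
  apply Real.exp_le_exp.mpr
  have e : (-(π:ℂ) * τ * (x + y * I) ^ 2 + c * (x + y * I)).re
      = - (π * τ.re) * x ^ 2 + (π * τ.re) * y ^ 2 + 2 * π * τ.im * x * y + c.re * x - c.im * y := by
    simp [pow_two]; ring
  rw [e]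
  have hy2 : y ^ 2 ≤ 1 := by rw [← sq_abs]; nlinarith [abs_nonneg y]
  have h1 : (π * τ.re) * y ^ 2 ≤ π * τ.re := by nlinarith
  have h2 : 2 * π * τ.im * x * y ≤ 2 * π * |τ.im| * |x| := by
    calc 2 * π * τ.im * x * y ≤ |2 * π * τ.im * x * y| := le_abs_self _
      _ = 2 * π * |τ.im| * |x| * |y| := by
        rw [abs_mul, abs_mul, abs_mul, abs_of_pos (by positivity : (0:ℝ) < 2 * π)]
      _ ≤ 2 * π * |τ.im| * |x| * 1 := by gcongr
      _ = _ := by ring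
  have h3 : c.re * x ≤ |c.re| * |x| := by rw [← abs_mul]; exact le_abs_self _
  have h4 : - (c.im * y) ≤ |c.im| := by
    calc -(c.im * y) ≤ |c.im * y| := neg_le_abs _
      _ = |c.im| * |y| := abs_mul _ _
      _ ≤ |c.im| * 1 := by gcongr
      _ = _ := by ring
  have h5 : B * |x| ≤ (π * τ.re / 2) * x ^ 2 + B ^ 2 / (2 * (π * τ.re)) := by
    have : (π * τ.re / 2) * x ^ 2 + B ^ 2 / (2 * (π * τ.re)) - B * |x|
        = (π * τ.re * |x| - B) ^ 2 / (2 * (π * τ.re)) := by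
      rw [← sq_abs x]; field_simp; ring
    have h6 : 0 ≤ (π * τ.re * |x| - B) ^ 2 / (2 * (π * τ.re)) := by positivity
    linarith
  have h7 : B * |x| = 2 * π * |τ.im| * |x| + |c.re| * |x| := by rw [hB]; ring
  linarith

lemma dN_bound (x y : ℝ) (hy : |y| ≤ 1) (hx : 2 ≤ |x|) : 1 / 2 ≤ ‖dN (x + y * I)‖ := by
  have hre : (2 * π * I * (oM * (x + y * I))).re = 2 * π * sS * (y - x) := by
    simp [oM]; ring
  have hn : ‖Complex.exp (2 * π * I * (oM * (x + y * I)))‖ = Real.exp (2 * π * sS * (y - x)) := by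
    rw [Complex.norm_exp, hre]
  have hs := sS_ge
  have hp := Real.pi_gt_three
  have hps : 1 ≤ 2 * π * sS := by nlinarith
  obtain ⟨hy1, hy2⟩ := abs_le.mp hy
  have h1 := Real.add_one_le_exp (1:ℝ)
  rw [dN]
  rcases le_abs.mp hx with h | h
  · have : Real.exp (2 * π * sS * (y - x)) ≤ Real.exp (-1) := by
      apply Real.exp_le_exp.mpr; nlinarith
    have h2 : Real.exp (-1) ≤ 1 / 2 := by
      rw [Real.exp_neg, one_div]; apply inv_anti₀ <;> linarith
    have h3 := norm_sub_norm_le 1 (Complex.exp (2 * π * I * (oM * (x + y * I))))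
    rw [norm_sub_rev, hn, norm_one] at h3
    linarith
  · have : Real.exp 1 ≤ Real.exp (2 * π * sS * (y - x)) := by
      apply Real.exp_le_exp.mpr; nlinarith
    have h3 := norm_sub_norm_le (Complex.exp (2 * π * I * (oM * (x + y * I)))) 1
    rw [hn, norm_one] at h3
    linarith

lemma dN_zero {w : ℂ} (h : dN w = 0) : ∃ n : ℤ, w.im = -sS * n := by
  rw [dN, sub_eq_zero, Complex.exp_eq_one_iff] at h
  obtain ⟨n, hn⟩ := h
  have h2 : oM * w = n := by
    have : (2 * (π:ℂ) * I) ≠ 0 := Complex.two_pi_I_ne_zero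
    apply mul_left_cancel₀ this; rw [hn]; ring
  refine ⟨n, ?_⟩
  have hr := congrArg Complex.re h2
  have hi := congrArg Complex.im h2
  simp [oM] at hr hi
  have := sS_pos
  have hsq := sS_sq
  have h3 : 2 * (sS * sS) * w.im = - sS * n := by
    linear_combination (-sS) * hr - sS * hi
  rw [hsq] at h3
  linarith

lemma dN_ne_line {y : ℝ} (hy : |y| = sS / 2) (x : ℝ) : dN (x + y * I) ≠ 0 := by
  intro h
  obtain ⟨n, hn⟩ := dN_zero h
  simp at hn
  have hs := sS_pos
  rw [hn, abs_neg, abs_mul, abs_of_pos hs] at hy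
  have : |(n:ℝ)| = 1 / 2 := by
    apply mul_left_cancel₀ hs.ne'; rw [hy]; ring
  have h2 : (2 * |n| : ℤ) = 1 := by
    have : (2 * |(n:ℝ)|) = 1 := by rw [this]; norm_num
    exact_mod_cast this
  omega

lemma dN_ne_strip {w : ℂ} (hw : |w.im| ≤ sS / 2) (h0 : w ≠ 0) : dN w ≠ 0 := by
  intro h
  obtain ⟨n, hn⟩ := dN_zero h
  have hs := sS_pos
  have hn0 : n = 0 := by
    rw [hn, abs_mul, abs_neg, abs_of_pos hs] at hw
    have h2 : |(n:ℝ)| ≤ 1 / 2 := by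
      by_contra! hc
      nlinarith
    have h3 : |(n:ℝ)| < 1 := by linarith
    have h4 : |n| < 1 := by exact_mod_cast h3
    exact Int.abs_lt_one_iff.mp h4
  subst hn0
  rw [dN, sub_eq_zero, Complex.exp_eq_one_iff] at h
  obtain ⟨k, hk⟩ := h
  have h2 : oM * w = k := by
    have : (2 * (π:ℂ) * I) ≠ 0 := Complex.two_pi_I_ne_zero
    apply mul_left_cancel₀ this; rw [hk]; ring
  have hi := congrArg Complex.im h2
  simp [oM] at hi hn
  rw [hn] at hi
  apply h0
  apply Complex.ext
  · simp at hi
    rcases hi with hi | hi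
    · exact absurd hi hs.ne'
    · simpa using hi
  · simpa using hn

lemma eN_diff (u τ : ℂ) : Differentiable ℂ (eN u τ) := by unfold eN; fun_prop
lemma dN_diff : Differentiable ℂ dN := by unfold dN; fun_prop

lemma int_line (u τ : ℂ) (hτ : 0 < τ.re) {y : ℝ} (hy : |y| = sS / 2) :
    Integrable (fun x : ℝ => eN u τ (x + y * I) / dN (x + y * I)) := by
  obtain ⟨C, hC⟩ := eN_bound u τ hτ
  have hy1 : |y| ≤ 1 := by rw [hy]; linarith [sS_le]
  have hcont : Continuous (fun x : ℝ => eN u τ (x + y * I) / dN (x + y * I)) := by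
    apply Continuous.div
    · exact (eN_diff u τ).continuous.comp (by fun_prop)
    · exact dN_diff.continuous.comp (by fun_prop)
    · exact dN_ne_line hy
  have hg : Integrable (fun x : ℝ => Real.exp (-(π * τ.re / 2) * x ^ 2)) :=
    integrable_exp_neg_mul_sq (by positivity)
  refine hcont.locallyIntegrable.integrable_of_isBigO_cocompact
    (g := fun x : ℝ => Real.exp (-(π * τ.re / 2) * x ^ 2)) ?_ (hg.integrableAtFilter _)
  apply Asymptotics.IsBigO.of_bound (2 * C)
  have hmem : ∀ᶠ x : ℝ in Filter.cocompact ℝ, 2 ≤ ‖x‖ :=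
    (tendsto_norm_cocompact_atTop (E := ℝ)).eventually_ge_atTop 2
  filter_upwards [hmem] with x hx
  have hd := dN_bound x y hy1 hx
  have hn := hC x y hy1
  rw [norm_div, div_le_iff₀ (by linarith), Real.norm_eq_abs, Real.abs_exp]
  have : 0 ≤ C * Real.exp (-(π * τ.re / 2) * x ^ 2) := le_trans (norm_nonneg _) hn
  nlinarith

/-- line integral -/
def jN (u τ : ℂ) (y : ℝ) : ℂ := ∫ x : ℝ, eN u τ (x + y * I) / dN (x + y * I)

lemma abs_half : |sS / 2| = sS / 2 := abs_of_pos (by linarith [sS_pos])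
lemma abs_neg_half : |-(sS / 2)| = sS / 2 := by rw [abs_neg, abs_half]

lemma ups_eq (u τ : ℂ) : Upsilon u τ = oM * jN u τ (-(sS / 2)) := by
  rw [jN, ← integral_add_right_eq_self _ (-(sS / 2)), ← integral_const_mul, Upsilon]
  congr 1; ext v
  rw [oM_eq]
  have hz : (1/2 + oM * v : ℂ)
      = oM * (((v + -(sS/2) : ℝ) : ℂ) + ((-(sS/2) : ℝ) : ℂ) * I) := by
    rw [← oM_conj]; push_cast; ring
  rw [hz, eN, dN]
  congr 3
  rw [mul_pow, oM_sq]
  linear_combination (π:ℂ) * τ * (((v + -(sS/2) : ℝ) : ℂ) + ((-(sS/2) : ℝ) : ℂ) * I) ^ 2 * Complex.I_sq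

lemma ups_shift (u τ : ℂ) :
    Upsilon (u + τ) τ = Complex.exp (π * I * (τ + 2 * u)) * (oM * jN u τ (sS / 2)) := by
  rw [jN, ← integral_add_right_eq_self _ (sS / 2), ← integral_const_mul, ← integral_const_mul,
    Upsilon]
  congr 1; ext v
  rw [oM_eq]
  set w : ℂ := ((v + sS/2 : ℝ) : ℂ) + ((sS/2 : ℝ) : ℂ) * I with hw
  have hz : (1/2 + oM * v : ℂ) = oM * w + 1 := by
    have := oM_conj
    rw [hw]; push_cast at *; linear_combination this
  have h1 : Complex.exp (2 * (π:ℂ) * I * (oM * w + 1)) = Complex.exp (2 * π * I * (oM * w)) := by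
    rw [mul_add, mul_one, Complex.exp_add, Complex.exp_two_pi_mul_I, mul_one]
  have h2 : Complex.exp (-(π:ℂ) * I * τ * (oM * w + 1) ^ 2 + 2 * π * I * (u + τ) * (oM * w + 1))
      = Complex.exp (π * I * (τ + 2 * u)) * eN u τ w := by
    rw [eN, ← Complex.exp_add]
    congr 1
    linear_combination (-(π:ℂ) * I * τ * w ^ 2) * oM_sq + (π:ℂ) * τ * w ^ 2 * Complex.I_sq
  rw [hz, h1, h2, dN]
  ring

lemma ups_one (u τ : ℂ) (hτ : 0 < τ.re) :
    Upsilon (u + 1) τ = Upsilon u τ + oM * τ ^ (-(1:ℂ)/2) * Complex.exp (π * I * u ^ 2 / τ) := by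
  have hτ0 : τ ≠ 0 := by rintro rfl; simp at hτ
  have hpi : (π:ℂ) ≠ 0 := by exact_mod_cast Real.pi_ne_zero
  rw [← sub_eq_iff_eq_add', ups_eq, ups_eq, ← mul_sub, jN, jN,
    ← integral_sub (int_line _ _ hτ abs_neg_half) (int_line _ _ hτ abs_neg_half), mul_assoc]
  congr 1
  set a : ℂ := ((-(sS/2) : ℝ) : ℂ) * I with ha
  have h : ∀ x : ℝ, eN (u + 1) τ (x + a) / dN (x + a) - eN u τ (x + a) / dN (x + a)
      = Complex.exp ((-(π:ℂ) * τ) * x ^ 2 + (-2 * π * τ * a + 2 * π * I * u * oM) * x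
        + (-(π:ℂ) * τ * a ^ 2 + 2 * π * I * u * oM * a)) := by
    intro x
    have hne : dN (x + a) ≠ 0 := dN_ne_line abs_neg_half x
    rw [← sub_div, div_eq_iff hne]
    have e1 : eN (u + 1) τ (x + a) = eN u τ (x + a) * Complex.exp (2 * π * I * (oM * (x + a))) := by
      rw [eN, eN, ← Complex.exp_add]; congr 1; ring
    have e2 : eN u τ (x + a) = Complex.exp ((-(π:ℂ) * τ) * x ^ 2
        + (-2 * π * τ * a + 2 * π * I * u * oM) * x
        + (-(π:ℂ) * τ * a ^ 2 + 2 * π * I * u * oM * a)) := by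
      rw [eN]; congr 1; ring
    rw [e1, ← e2, dN]; ring
  simp_rw [h]
  rw [integral_cexp_quadratic (by simp; positivity)]
  have h1 : ((π:ℂ) / -(-(π:ℂ) * τ)) = τ⁻¹ := by field_simp
  have harg : τ.arg ≠ π := by
    intro h
    have := Complex.arg_eq_pi_iff.mp h
    linarith [this.1]
  rw [h1, Complex.inv_cpow _ _ harg, ← Complex.cpow_neg, show (-(1:ℂ)/2) = -(1/2) by ring]
  congr 2
  field_simp
  linear_combination (4 * I ^ 2 * u ^ 2) * oM_sq - 4 * I * u ^ 2 * Complex.I_sq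

lemma dN_dslope_ne {w : ℂ} (hw : |w.im| ≤ sS / 2) : dslope dN 0 w ≠ 0 := by
  by_cases h0 : w = 0
  · subst h0
    rw [dslope_same]
    have : HasDerivAt dN (Complex.exp (2 * π * I * (oM * 0)) * (2 * π * I * (oM * 1))) 0 := by
      unfold dN
      exact ((((hasDerivAt_id (0:ℂ)).const_mul oM).const_mul (2 * π * I : ℂ)).cexp).sub_const 1
    rw [this.deriv]
    have ho : oM ≠ 0 := by
      intro h
      have := oM_sq
      rw [h] at this
      have := congrArg Complex.im this
      simp at this
    have := Complex.two_pi_I_ne_zero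
    simp [ho]
  · rw [dslope_of_ne _ h0, slope_def_field]
    have : dN 0 = 0 := by simp [dN]
    rw [this, sub_zero, sub_zero]
    exact div_ne_zero (dN_ne_strip hw h0) h0

lemma contour (u τ u' τ' : ℂ) (hτ : 0 < τ.re) (hτ' : 0 < τ'.re) :
    jN u τ (-(sS/2)) - jN u' τ' (-(sS/2)) = jN u τ (sS/2) - jN u' τ' (sS/2) := by
  set N : ℂ → ℂ := fun w => eN u τ w - eN u' τ' w with hN
  set K : ℂ → ℂ := fun w => dslope N 0 w / dslope dN 0 w with hK
  have hs := sS_pos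
  have hs1 := sS_le
  have hN0 : N 0 = 0 := by simp [hN, eN]
  have hd0 : dN 0 = 0 := by simp [dN]
  have hKeq : ∀ w, w ≠ 0 → K w = eN u τ w / dN w - eN u' τ' w / dN w := by
    intro w hw
    simp only [hK]
    rw [dslope_of_ne _ hw, dslope_of_ne _ hw, slope_def_field, slope_def_field, hN0, hd0]
    simp only [sub_zero, hN]
    rw [div_div_div_cancel_right₀ hw, sub_div]
  have hNd : Differentiable ℂ (dslope N 0) := by
    rw [← differentiableOn_univ, Complex.differentiableOn_dslope Filter.univ_mem]
    exact ((eN_diff u τ).sub (eN_diff u' τ')).differentiableOn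
  have hDd : Differentiable ℂ (dslope dN 0) := by
    rw [← differentiableOn_univ, Complex.differentiableOn_dslope Filter.univ_mem]
    exact dN_diff.differentiableOn
  have hKd : ∀ w : ℂ, |w.im| ≤ sS / 2 → DifferentiableAt ℂ K w := fun w hw =>
    (hNd w).div (hDd w) (dN_dslope_ne hw)
  have hne : ∀ (x : ℝ) {y : ℝ}, y ≠ 0 → ((x:ℂ) + y * I) ≠ 0 := by
    intro x y hy h
    have := congrArg Complex.im h
    simp at this
    exact hy this
  have hline : ∀ y : ℝ, |y| = sS / 2 → Integrable (fun x : ℝ => K (x + y * I)) ∧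
      ∫ x : ℝ, K (x + y * I) = jN u τ y - jN u' τ' y := by
    intro y hy
    have hy0 : y ≠ 0 := by rintro rfl; simp at hy; linarith
    have i1 := int_line u τ hτ hy
    have i2 := int_line u' τ' hτ' hy
    have e : (fun x : ℝ => K (x + y * I)) = fun x : ℝ => eN u τ (x + y * I) / dN (x + y * I)
        - eN u' τ' (x + y * I) / dN (x + y * I) := by
      ext x; exact hKeq _ (hne x hy0)
    rw [e]
    exact ⟨i1.sub i2, integral_sub i1 i2⟩
  obtain ⟨C, hC⟩ := eN_bound u τ hτ
  obtain ⟨C', hC'⟩ := eN_bound u' τ' hτ'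
  set g : ℝ → ℝ := fun x => 2 * (C * Real.exp (-(π * τ.re / 2) * x ^ 2)
    + C' * Real.exp (-(π * τ'.re / 2) * x ^ 2)) with hg
  have hKb : ∀ x y : ℝ, |y| ≤ 1 → 2 ≤ |x| → ‖K (x + y * I)‖ ≤ g x := by
    intro x y hy hx
    have hw : ((x:ℂ) + y * I) ≠ 0 := by
      intro h
      have := congrArg Complex.re h
      simp at this
      rw [this] at hx; norm_num at hx
    have hd := dN_bound x y hy hx
    rw [hKeq _ hw, ← sub_div, norm_div, div_le_iff₀ (by linarith)]
    have h1 := hC x y hy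
    have h2 := hC' x y hy
    have h3 := norm_sub_le (eN u τ (x + y * I)) (eN u' τ' (x + y * I))
    have h4 : 0 ≤ g x := by
      simp only [hg]
      linarith [norm_nonneg (eN u τ (x + y * I)), norm_nonneg (eN u' τ' (x + y * I))]
    have h5 : g x * (1 / 2) ≤ g x * ‖dN (x + y * I)‖ := by gcongr
    simp only [hg] at h5 ⊢
    linarith
  have hg0 : Filter.Tendsto g Filter.atTop (nhds 0) := by
    have aux : ∀ b : ℝ, 0 < b →
        Filter.Tendsto (fun x : ℝ => Real.exp (-b * x ^ 2)) Filter.atTop (nhds 0) := by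
      intro b hb
      apply Real.tendsto_exp_atBot.comp
      exact (Filter.tendsto_pow_atTop two_ne_zero).const_mul_atTop_of_neg (by linarith)
    have := (((aux (π * τ.re / 2) (by positivity)).const_mul C).add
      ((aux (π * τ'.re / 2) (by positivity)).const_mul C')).const_mul 2
    simpa [hg] using this
  have hgneg : ∀ x, g (-x) = g x := by intro x; simp [hg]
  have hrect : ∀ R : ℝ, (∫ x in (-R)..R, K (x + ((-(sS/2) : ℝ) : ℂ) * I))
      - (∫ x in (-R)..R, K (x + ((sS/2 : ℝ) : ℂ) * I))
      = I • (∫ y in (-(sS/2))..(sS/2), K (((-R : ℝ) : ℂ) + y * I))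
        - I • (∫ y in (-(sS/2))..(sS/2), K ((R : ℂ) + y * I)) := by
    intro R
    have := Complex.integral_boundary_rect_eq_zero_of_differentiableOn K
      (⟨-R, -(sS/2)⟩ : ℂ) (⟨R, sS/2⟩ : ℂ) (by
        intro w hw
        apply (hKd w _).differentiableWithinAt
        have h2 := hw.2
        simp only [Set.mem_preimage] at h2
        rw [Set.uIcc_of_le (by linarith)] at h2
        exact abs_le.mpr h2)
    simp only at this
    linear_combination this
  have hv : ∀ σ : ℝ, |σ| = 1 → Filter.Tendsto (fun R : ℝ =>
      I • (∫ y in (-(sS/2))..(sS/2), K (((σ * R : ℝ) : ℂ) + y * I))) Filter.atTop (nhds 0) := by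
    intro σ hσ
    apply squeeze_zero_norm' (a := fun R => g R * |sS/2 - -(sS/2)|)
    · filter_upwards [Filter.eventually_ge_atTop 2] with R hR
      rw [norm_smul, Complex.norm_I, one_mul]
      apply intervalIntegral.norm_integral_le_of_norm_le_const
      intro y hy
      rw [Set.uIoc_of_le (by linarith)] at hy
      have hgσ : g (σ * R) = g R := by
        rcases (abs_eq (by norm_num)).mp hσ with h | h <;> rw [h] <;> simp [hgneg]
      rw [← hgσ]
      apply hKb
      · rw [abs_le]; constructor <;> linarith [hy.1, hy.2]
      · rw [abs_mul, hσ, one_mul]; exact le_trans hR (le_abs_self _)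
    · simpa using hg0.mul_const (|sS/2 - -(sS/2)|)
  obtain ⟨im, em⟩ := hline _ abs_neg_half
  obtain ⟨ip, ep⟩ := hline _ abs_half
  have t1 := (intervalIntegral_tendsto_integral im Filter.tendsto_neg_atTop_atBot
    Filter.tendsto_id).sub (intervalIntegral_tendsto_integral ip Filter.tendsto_neg_atTop_atBot
    Filter.tendsto_id)
  have t2 := (hv (-1) (by norm_num)).sub (hv 1 (by norm_num))
  rw [em, ep] at t1
  simp only [neg_one_mul, one_mul, sub_zero] at t2
  have t3 := t2.congr (fun R => (hrect R).symm)
  exact sub_eq_zero.mp (tendsto_nhds_unique t1 t3)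

lemma jump (u τ : ℂ) (hτ : 0 < τ.re) :
    oM * jN u τ (sS/2) = Upsilon u τ - 1 := by
  have hc := contour u τ (-1/2) 1 hτ (by simp)
  have h1 := ups_shift (-1/2) 1
  have h2 := ups_one (-1/2) 1 (by simp)
  have h3 := ups_eq (-1/2) 1
  have h4 : oM * Complex.exp (π * I * (-1/2) ^ 2 / 1) = -1 := by
    rw [← oM_eq, ← Complex.exp_add]
    refine Eq.trans ?_ Complex.exp_pi_mul_I
    congr 1; ring
  rw [Complex.one_cpow, mul_one, h4] at h2
  have h5 : (π:ℂ) * I * (1 + 2 * (-1/2)) = 0 := by ring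
  rw [h5, Complex.exp_zero, one_mul] at h1
  rw [ups_eq]
  linear_combination (-oM) * hc - h1 + h2 + h3

lemma ups_tau (u τ : ℂ) (hτ : 0 < τ.re) :
    Upsilon (u + τ) τ = Complex.exp (π * I * (τ + 2 * u)) * (Upsilon u τ - 1) := by
  rw [ups_shift, jump u τ hτ]

theorem statement7 (u τ : ℂ) (hτ : 0 < τ.re) (m n : ℕ) :
    Upsilon (u + m) τ = Upsilon u τ + Complex.exp (3*(π:ℂ)*I/4) * τ ^ (-(1:ℂ)/2) *
        ∑ j ∈ Finset.range m, Complex.exp ((π:ℂ)*I*((j:ℂ) + u)^2/τ) ∧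
    Upsilon (u + n*τ) τ = Complex.exp ((π:ℂ)*I*(n:ℂ)*((n:ℂ)*τ + 2*u)) * Upsilon u τ -
        Complex.exp ((π:ℂ)*I*((n:ℂ)*τ + u)^2/τ) *
          ∑ j ∈ Finset.range n, Complex.exp (-(π:ℂ)*I*((j:ℂ)*τ + u)^2/τ) := by
  have hτ0 : τ ≠ 0 := by rintro rfl; simp at hτ
  constructor
  · induction m with
    | zero => simp
    | succ k ih =>
      rw [Finset.sum_range_succ, Nat.cast_succ, ← add_assoc, ups_one _ _ hτ, ih, oM_eq,
        add_comm u (k:ℂ)]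
      ring
  · induction n with
    | zero => simp
    | succ k ih =>
      have e0 : u + ((k + 1 : ℕ) : ℂ) * τ = (u + k * τ) + τ := by push_cast; ring
      rw [e0, ups_tau _ _ hτ, ih, Finset.sum_range_succ]
      have e1 : Complex.exp ((π:ℂ)*I*((k + 1 : ℕ):ℂ)*(((k + 1 : ℕ):ℂ)*τ + 2*u))
          = Complex.exp (π * I * (τ + 2 * (u + k * τ)))
            * Complex.exp ((π:ℂ)*I*(k:ℂ)*((k:ℂ)*τ + 2*u)) := by
        rw [← Complex.exp_add]; congr 1; push_cast; ring
      have e2 : Complex.exp ((π:ℂ)*I*(((k + 1 : ℕ):ℂ)*τ + u)^2/τ)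
          = Complex.exp (π * I * (τ + 2 * (u + k * τ)))
            * Complex.exp ((π:ℂ)*I*((k:ℂ)*τ + u)^2/τ) := by
        rw [← Complex.exp_add]; congr 1; push_cast; field_simp; ring
      have e3 : Complex.exp ((π:ℂ)*I*((k:ℂ)*τ + u)^2/τ)
          * Complex.exp (-(π:ℂ)*I*((k:ℂ)*τ + u)^2/τ) = 1 := by
        rw [← Complex.exp_add, ← Complex.exp_zero]; congr 1; ring
      rw [e1, e2]
      linear_combination (Complex.exp (π * I * (τ + 2 * (u + k * τ)))) * e3

end
end

section
/- For all u, τ ∈ ℂ with Re(τ) > 0: (i) Υ(u/τ; 1/τ) = √τ · e^{πi(u²/τ − 1/4)} · conj(Υ(conj(u); conj(τ))); (ii) G(u; 1/τ) = conj(G(conj(u); conj(τ))); and (iii) for every k ∈ ℤ_{≥0}, G^{(k)}(u; 1/τ) = conj(G^{(k)}(conj(u); conj(τ))), where √τ is the principal square root and conj denotes complex conjugation. -/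
open Complex Real MeasureTheory

noncomputable section

lemma aux_strip (H : ℂ → ℂ) (h : ℝ) (hh : 0 ≤ h)
    (hd : ∀ z : ℂ, 0 ≤ z.im → z.im ≤ h → DifferentiableAt ℂ H z)
    (hi0 : Integrable fun x : ℝ => H x) (hi1 : Integrable fun x : ℝ => H (x + h * I))
    (B : ℝ → ℝ) (hB : Filter.Tendsto B Filter.atTop (nhds 0))
    (hb : ∀ᶠ T : ℝ in Filter.atTop, ∀ y : ℝ, 0 ≤ y → y ≤ h →
      ‖H (T + y * I)‖ ≤ B T ∧ ‖H (-T + y * I)‖ ≤ B T) :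
    ∫ x : ℝ, H x = ∫ x : ℝ, H (x + h * I) := by
  have key : ∀ T : ℝ, (∫ x : ℝ in (-T)..T, H x) - (∫ x : ℝ in (-T)..T, H (x + h * I)) =
      - (I • ∫ y : ℝ in (0:ℝ)..h, H (T + y * I)) + I • ∫ y : ℝ in (0:ℝ)..h, H (-T + y * I) := by
    intro T
    have := Complex.integral_boundary_rect_eq_zero_of_differentiableOn H (-T : ℂ) (T + h * I) ?_
    · simp at this
      simp only [smul_eq_mul]
      linear_combination this
    · intro z hz
      apply DifferentiableAt.differentiableWithinAt
      rw [Complex.mem_reProdIm] at hz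
      have h2 := hz.2
      simp [Set.uIcc_of_le hh] at h2
      exact hd z h2.1 h2.2
  have t0 := intervalIntegral_tendsto_integral hi0 Filter.tendsto_neg_atTop_atBot Filter.tendsto_id
  have t1 := intervalIntegral_tendsto_integral hi1 Filter.tendsto_neg_atTop_atBot Filter.tendsto_id
  have t2 := t0.sub t1
  simp only [id] at t2
  have t3 : Filter.Tendsto (fun T : ℝ => (∫ x : ℝ in (-T)..T, H x) -
      (∫ x : ℝ in (-T)..T, H (x + h * I))) Filter.atTop (nhds 0) := by
    have hB2 : Filter.Tendsto (fun T => B T * h + B T * h) Filter.atTop (nhds 0) := by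
      simpa using (hB.mul_const h).add (hB.mul_const h)
    apply squeeze_zero_norm' _ hB2
    filter_upwards [hb] with T hT
    rw [key]
    refine (norm_add_le _ _).trans ?_
    rw [norm_neg, norm_smul, norm_smul, Complex.norm_I, one_mul, one_mul]
    have e1 := intervalIntegral.norm_integral_le_of_norm_le_const (a := 0) (b := h)
      (f := fun y : ℝ => H (T + y * I)) (C := B T) (by
        intro y hy; rw [Set.uIoc_of_le hh] at hy; exact (hT y hy.1.le hy.2).1)
    have e2 := intervalIntegral.norm_integral_le_of_norm_le_const (a := 0) (b := h)
      (f := fun y : ℝ => H (-T + y * I)) (C := B T) (by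
        intro y hy; rw [Set.uIoc_of_le hh] at hy; exact (hT y hy.1.le hy.2).2)
    rw [sub_zero, abs_of_nonneg hh] at e1 e2
    linarith
  exact sub_eq_zero.mp (tendsto_nhds_unique t2 t3)

lemma aux_int_lor (b : ℝ) (hb : 0 < b) : Integrable (fun x : ℝ => b / (x^2 + b^2)) ∧
    ∫ x : ℝ, b / (x^2 + b^2) = π := by
  have e : (fun x : ℝ => b / (x^2 + b^2)) = fun x => b⁻¹ * (1 + (b⁻¹ * x)^2)⁻¹ := by
    funext x; field_simp; ring_nf
  rw [e]
  refine ⟨(integrable_inv_one_add_sq.comp_mul_left' (inv_ne_zero hb.ne')).const_mul _, ?_⟩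
  rw [integral_const_mul, Measure.integral_comp_mul_left (fun x => (1 + x^2)⁻¹),
    integral_univ_inv_one_add_sq]
  simp [abs_of_pos hb]
  field_simp

lemma aux_ne (x b : ℝ) (hb : b ≠ 0) : (x : ℂ) - b * I ≠ 0 := by
  intro h
  have := congrArg Complex.im h
  simp at this
  exact hb this

/-- bound on the kernel -/
lemma aux_ker_int (α β : ℝ) (ha : α ≠ 0) (hb : β ≠ 0) :
    Integrable (fun x : ℝ => 1 / ((x:ℂ) - α * I) - 1 / ((x:ℂ) - β * I)) := by
  set m := min |α| |β| with hm
  have hm0 : 0 < m := lt_min (abs_pos.mpr ha) (abs_pos.mpr hb)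
  have hn : ∀ (x γ : ℝ), m ≤ |γ| → Real.sqrt (x^2 + m^2) ≤ ‖(x:ℂ) - γ * I‖ := by
    intro x γ h
    apply Real.sqrt_le_iff.mpr ⟨norm_nonneg _, _⟩
    rw [← Complex.normSq_eq_norm_sq, Complex.normSq_apply]
    simp
    have : m^2 ≤ γ^2 := by rw [← sq_abs γ]; gcongr
    nlinarith
  refine Integrable.mono' (g := fun x => |α - β| / m * (m / (x^2+m^2)))
    ((aux_int_lor m hm0).1.const_mul _) ?_ ?_
  · apply Continuous.aestronglyMeasurable
    have h1 := fun x => aux_ne x α ha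
    have h2 := fun x => aux_ne x β hb
    fun_prop (disch := assumption)
  · refine Filter.Eventually.of_forall fun x => ?_
    rw [div_sub_div _ _ (aux_ne x α ha) (aux_ne x β hb), norm_div, norm_mul]
    have e : (1 * ((x:ℂ) - β * I) - (x - α * I) * 1) = ((α - β : ℝ) : ℂ) * I := by
      push_cast; ring
    rw [e, norm_mul, Complex.norm_I, mul_one, Complex.norm_real, Real.norm_eq_abs]
    have p : 0 < x^2 + m^2 := by positivity
    have : x^2 + m^2 ≤ ‖(x:ℂ) - α * I‖ * ‖(x:ℂ) - β * I‖ := by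
      rw [← Real.mul_self_sqrt p.le]
      exact mul_le_mul (hn x α (min_le_left _ _)) (hn x β (min_le_right _ _))
        (Real.sqrt_nonneg _) (norm_nonneg _)
    rw [div_mul_div_cancel₀ hm0.ne']
    gcongr

lemma aux_ker (α β : ℝ) (ha : α ≠ 0) (hb : β ≠ 0) :
    ∫ x : ℝ, (1 / ((x:ℂ) - α * I) - 1 / ((x:ℂ) - β * I)) =
    I * ((∫ x : ℝ, α / (x^2 + α^2) : ℝ) - (∫ x : ℝ, β / (x^2+β^2) : ℝ) : ℂ) := by
  have hl : ∀ b : ℝ, b ≠ 0 → Integrable (fun x : ℝ => b / (x^2 + b^2)) := by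
    intro b hb
    rcases lt_or_gt_of_ne hb with h | h
    · have := (aux_int_lor (-b) (by linarith)).1.neg
      refine this.congr (Filter.Eventually.of_forall fun x => ?_)
      simp [neg_div]
    · exact (aux_int_lor b h).1
  set K := (fun x : ℝ => 1 / ((x:ℂ) - α * I) - 1 / ((x:ℂ) - β * I)) with hK
  have hi : Integrable K := aux_ker_int α β ha hb
  have h1 : ∫ x, K (-x) = ∫ x, K x := integral_neg_eq_self K _
  have h2 : ∫ x, (K x + K (-x)) = 2 * ∫ x, K x := by
    rw [integral_add hi hi.comp_neg, h1]; ring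
  have h3 : ∀ x, K x + K (-x) = 2 * I * ((α / (x^2 + α^2) - β / (x^2+β^2) : ℝ) : ℂ) := by
    intro x
    have q : ∀ b : ℝ, b ≠ 0 → 1 / ((x:ℂ) - b * I) + 1 / (((-x:ℝ):ℂ) - b * I) =
        2 * I * ((b / (x^2+b^2) : ℝ) : ℂ) := by
      intro b hb
      have n1 := aux_ne x b hb
      have n2 := aux_ne (-x) b hb
      have n3 : ((x:ℂ)^2 + b^2) ≠ 0 := by
        norm_cast; positivity
      push_cast at *
      rw [div_add_div _ _ n1 n2, mul_div_assoc', div_eq_div_iff (mul_ne_zero n1 n2) n3]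
      linear_combination (-2 * I * b ^ 3) * (Complex.I_sq)
    have := q α ha
    have := q β hb
    simp only [hK]
    rw [Complex.ofReal_sub, mul_sub, ← q α ha, ← q β hb]; ring
  simp_rw [h3] at h2
  rw [integral_const_mul, integral_complex_ofReal, integral_sub (hl α ha) (hl β hb)] at h2
  push_cast at h2
  linear_combination (-1/2 : ℂ) * h2

lemma aux_norm_cosh (z : ℂ) : ‖Complex.cosh z‖^2 = Real.sinh z.re ^2 + Real.cos z.im ^2 := by
  conv_lhs => rw [← Complex.re_add_im z]
  rw [← Complex.normSq_eq_norm_sq, Complex.cosh_add,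
    Complex.cosh_mul_I, Complex.sinh_mul_I, ← Complex.ofReal_cosh, ← Complex.ofReal_sinh,
    ← Complex.ofReal_cos, ← Complex.ofReal_sin, Complex.normSq_apply]
  simp only [Complex.add_re, Complex.mul_re, Complex.add_im, Complex.mul_im, Complex.ofReal_re,
    Complex.ofReal_im, Complex.I_re, Complex.I_im]
  have h3 := Real.sin_sq_add_cos_sq z.im
  have := Real.cosh_sq z.re
  have h3 : Real.sin z.im ^2 = 1 - Real.cos z.im^2 := by linarith
  ring_nf
  rw [h3, this]; ring

lemma aux_cosh_lb (s : ℝ) : (1 + s^2)/3 ≤ ‖Complex.cosh (((1:ℂ) + I) * s)‖ := by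
  have e1 : ‖Complex.cosh (((1:ℂ) + I) * s)‖^2 = (Real.cosh (2*s) + Real.cos (2*s))/2 := by
    rw [aux_norm_cosh]
    simp
    rw [Real.cosh_two_mul, Real.cos_two_mul, Real.cosh_sq]
    ring
  have e2 : 1 + (2*s)^2/2 + (2*s)^4/24 ≤ Real.cosh (2*s) := by
    have := (Real.hasSum_cosh (2*s))
    have := sum_le_hasSum (Finset.range 3) (fun i _ => by
      have : 0 ≤ (2*s)^(2*i) := by rw [pow_mul]; positivity
      positivity) this
    simp [Finset.sum_range_succ, Nat.factorial] at this
    linarith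
  have e3 := Real.one_sub_sq_div_two_le_cos (x := 2*s)
  have : ((1 + s^2)/3)^2 ≤ ‖Complex.cosh (((1:ℂ) + I) * s)‖^2 := by
    rw [e1]; nlinarith [sq_nonneg (s^2-1)]
  exact le_of_sq_le_sq this (norm_nonneg _)

lemma aux_sinh_lb (z : ℂ) : |z.re| ≤ ‖Complex.cosh z‖ := by
  have e1 := aux_norm_cosh z
  have h : |z.re| ≤ |Real.sinh z.re| := by
    rw [Real.abs_sinh]
    exact Real.self_le_sinh_iff.mpr (abs_nonneg _)
  refine h.trans ?_
  apply abs_le_of_sq_le_sq _ (norm_nonneg _)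
  rw [e1]; nlinarith [sq_nonneg (Real.cos z.im)]


lemma aux_F_ne (c : ℝ) (hc : 0 < c) (hc2 : c^2 = 1/2) (v : ℂ)
    (h1 : -(c/2) < v.im) (h2 : v.im < 3*c/2) (hv : v ≠ c * (1+I) / 2) :
    Complex.cosh (π * (c * (1+I)) * v) ≠ 0 := by
  intro h
  have hcc : (c:ℂ)^2 = 1/2 := by rw [← Complex.ofReal_pow, hc2]; simp
  rw [← Complex.cos_mul_I, Complex.cos_eq_zero_iff] at h
  obtain ⟨k, hk⟩ := h
  have hpi : (π:ℂ) ≠ 0 := by exact_mod_cast Real.pi_ne_zero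
  have hk2 : (c * (1+I)) * v * I = (2*k+1)/2 := by
    apply mul_left_cancel₀ hpi
    linear_combination hk
  have hk3 : v = -((2*k+1)/2) * (c*(1+I)) := by
    have : (c * (1+I))^2 = I := by
      linear_combination (1+I)^2 * hcc + 1/2 * Complex.I_sq
    linear_combination -(c*(1+I)) * hk2 + v * I * this + v * Complex.I_sq
  have him : v.im = -((2*k+1)/2) * c := by
    rw [hk3]
    have : (-((2*(k:ℂ)+1)/2) * (c*(1+I))) = ((-((2*(k:ℝ)+1)/2) * c : ℝ) : ℂ) * (1+I) := by
      push_cast; ring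
    rw [this, Complex.re_ofReal_mul |> fun _ => Complex.im_ofReal_mul]
    simp
  have k1 : (-1:ℝ) < -(2*k+1) := by nlinarith
  have k2 : -(2*k+1 : ℝ) < 3 := by nlinarith
  have k1' : (-1:ℤ) < -(2*k+1) := by exact_mod_cast k1
  have k2' : -(2*k+1 : ℤ) < 3 := by exact_mod_cast k2
  have : k = -1 := by omega
  subst this
  apply hv
  rw [hk3]; push_cast; ring

lemma aux_F_int (c : ℝ) (hc : 0 < c) :
    Integrable (fun v : ℝ => (Complex.cosh (π * (c * (1+I)) * v))⁻¹) := by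
  have hb : ∀ v : ℝ, (1 + (π*c*v)^2)/3 ≤ ‖Complex.cosh (π * (c * (1+I)) * v)‖ := by
    intro v
    have := aux_cosh_lb (π*c*v)
    convert this using 3
    push_cast; ring
  refine Integrable.mono' (g := fun v => 3 * (1 + (π*c*v)^2)⁻¹)
    ((integrable_inv_one_add_sq.comp_mul_left' (by positivity)).const_mul _) ?_ ?_
  · apply Continuous.aestronglyMeasurable
    apply Continuous.inv₀ (by fun_prop)
    intro v h
    have := hb v
    rw [h, norm_zero] at this
    nlinarith [sq_nonneg (π*c*v)]
  · refine Filter.Eventually.of_forall fun v => ?_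
    rw [norm_inv]
    calc _ ≤ ((1 + (π*c*v)^2)/3)⁻¹ := by
          apply inv_anti₀ _ (hb v); positivity
      _ = _ := by field_simp

lemma aux_f_int (c : ℝ) (hc : 0 < c) (w : ℝ) :
    Integrable (fun v : ℝ => cexp (-2*π*I*v*w) * (Complex.cosh (π * (c * (1+I)) * v))⁻¹) := by
  refine (aux_F_int c hc).norm.mono' ?_ ?_
  · exact (Continuous.aestronglyMeasurable (by fun_prop)).mul (aux_F_int c hc).1
  · refine Filter.Eventually.of_forall fun v => ?_
    rw [norm_mul]
    have : -2*(π:ℂ)*I*v*w = ((-2*π*v*w : ℝ):ℂ) * I := by push_cast; ring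
    rw [this, Complex.norm_exp_ofReal_mul_I, one_mul]

set_option maxHeartbeats 1000000 in
lemma aux_FT (c : ℝ) (hc : 0 < c) (hc2 : c^2 = 1/2) (w : ℝ) :
    ∫ v : ℝ, cexp (-2*π*I*v*w) * (Complex.cosh (π * (c * (1+I)) * v))⁻¹ =
      (c * (1+I) * Complex.cosh (π * I * (c * (1+I)) * w))⁻¹ := by
  have hcc : (c:ℂ)^2 = 1/2 := by rw [← Complex.ofReal_pow, hc2]; simp
  have hpi : (π:ℂ) ≠ 0 := by exact_mod_cast Real.pi_ne_zero
  set a : ℂ := c * (1+I) with ha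
  have ha2 : a^2 = I := by
    rw [ha]; linear_combination (1+I)^2 * hcc + 1/2 * Complex.I_sq
  have ha0 : a ≠ 0 := by
    intro h; rw [h] at ha2; simp at ha2; exact Complex.I_ne_zero ha2.symm
  set p : ℂ := a / 2 with hp
  have hpre : p.re = c/2 := by simp [hp, ha]
  have hpim : p.im = c/2 := by simp [hp, ha]
  set q : ℂ := p + c * I with hq
  have hqim : q.im = 3*c/2 := by simp [hq, hpim]; ring
  set f : ℂ → ℂ := fun v => cexp (-2*π*I*v*w) * (Complex.cosh (π * a * v))⁻¹ with hf
  set C : ℂ → ℂ := fun v => Complex.cosh (π * a * v) with hC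
  have hCd : Differentiable ℂ C := by fun_prop
  have hCp : C p = 0 := by
    simp only [hC, hp]
    rw [show π * a * (a/2) = (π/2:ℂ) * I by linear_combination π/2 * ha2, Complex.cosh_mul_I,
      Complex.cos_pi_div_two]
  have hCp' : deriv C p = π * a * I := by
    have h1 : HasDerivAt C (Complex.sinh (π * a * p) * (π * a * 1)) p :=
      ((hasDerivAt_id p).const_mul (π * a)).ccosh
    rw [h1.deriv, hp, show π * a * (a/2) = (π/2:ℂ) * I by linear_combination π/2 * ha2,
      Complex.sinh_mul_I, Complex.sin_pi_div_two]
    ring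
  set D := dslope C p with hD
  have hDd : Differentiable ℂ D := by
    have := (Complex.differentiableOn_dslope (s := Set.univ) (c := p) (f := C) Filter.univ_mem).mpr
      hCd.differentiableOn
    exact differentiableOn_univ.mp this
  have hDC : ∀ v, (v - p) * D v = C v := by
    intro v
    have := sub_smul_dslope C p v
    rw [hCp, sub_zero, smul_eq_mul] at this
    exact this
  set S : Set ℂ := {v | -(c/2) < v.im ∧ v.im < 3*c/2} with hS
  have hSo : IsOpen S :=
    (isOpen_lt continuous_const Complex.continuous_im).inter
      (isOpen_lt Complex.continuous_im continuous_const)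
  have hpS : p ∈ S := by
    constructor <;> rw [hpim] <;> linarith
  have hDne : ∀ v ∈ S, D v ≠ 0 := by
    intro v hv h0
    by_cases hvp : v = p
    · rw [hvp, hD, dslope_same, hCp'] at h0
      simp [hpi, ha0] at h0
    · apply aux_F_ne c hc hc2 v hv.1 hv.2 hvp
      change C v = 0
      rw [← hDC, h0, mul_zero]
  set k : ℂ → ℂ := fun v => cexp (-2*π*I*v*w) * (D v)⁻¹ with hk
  have hkd : DifferentiableOn ℂ k S := by
    apply DifferentiableOn.mul (by fun_prop)
    exact hDd.differentiableOn.inv hDne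
  have hkd2 : DifferentiableOn ℂ (dslope k p) S :=
    (Complex.differentiableOn_dslope (hSo.mem_nhds hpS)).mpr hkd
  set r := k p with hr
  have hrv : r = cexp (-π*I*a*w) * (π * a * I)⁻¹ := by
    rw [hr, hk]
    simp only
    rw [hD, dslope_same, hCp', hp]
    congr 2; ring
  set H : ℂ → ℂ := fun v => dslope k p v + r / (v - q) with hH
  have hHf : ∀ v ∈ S, v ≠ p → H v = f v - r * (1 / (v - p) - 1 / (v - q)) := by
    intro v hv hvp
    have h1 : v - p ≠ 0 := sub_ne_zero.mpr hvp
    have h2 : v - q ≠ 0 := by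
      intro h
      have := sub_eq_zero.mp h
      have h3 := hv.2
      rw [this, hqim] at h3
      exact lt_irrefl _ h3
    have h3 : f v = k v / (v - p) := by
      simp only [hf, hk]
      change _ * (C v)⁻¹ = _
      rw [← hDC v]
      have := hDne v hv
      field_simp
    simp only [hH]
    rw [dslope_of_ne _ hvp, slope_def_field, h3]
    field_simp
    ring
  have hlin : ∀ (x y : ℝ), 0 ≤ y → y ≤ c → ((x:ℂ) + y * I) ∈ S := by
    intro x y h0 h1
    constructor <;> simp <;> linarith
  have hf0 : Integrable (fun x : ℝ => f x) := aux_f_int c hc w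
  have hshift : ∀ v, f (v + a) = - cexp (-2*π*I*a*w) * f v := by
    intro v
    simp only [hf]
    rw [show π * a * (v + a) = π * a * v + π * I by linear_combination π * ha2,
      Complex.cosh_add, Complex.cosh_mul_I, Complex.sinh_mul_I, Complex.cos_pi, Complex.sin_pi,
      show -2 * π * I * (v + a) * w = -2*π*I*v*w + -2*π*I*a*w by ring, Complex.exp_add]
    simp
    ring
  have hsh2 : ∀ x : ℝ, f ((x:ℂ) + c * I) = - cexp (-2*π*I*a*w) * f ((x - c : ℝ) : ℂ) := by
    intro x
    rw [← hshift, ha]; congr 1; push_cast; ring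
  have hf1 : Integrable (fun x : ℝ => f (x + c * I)) := by
    simp_rw [hsh2]
    exact (hf0.comp_sub_right c).const_mul _
  have hJ1 : ∫ x : ℝ, f (x + c * I) = - cexp (-2*π*I*a*w) * ∫ x : ℝ, f x := by
    simp_rw [hsh2]
    rw [integral_const_mul, integral_sub_right_eq_self (fun x : ℝ => f x)]
  have hc0 := hc.ne'
  have hR0e : ∀ x : ℝ, 1 / ((x:ℂ) - p) - 1 / (x - q) =
      1 / (((x - c/2 : ℝ):ℂ) - (c/2 : ℝ) * I) - 1 / (((x - c/2 : ℝ):ℂ) - (3*c/2 : ℝ) * I) := by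
    intro x
    congr 2 <;> simp only [hq, hp, ha] <;> push_cast <;> ring
  have hR1e : ∀ x : ℝ, 1 / ((x:ℂ) + c * I - p) - 1 / (x + c * I - q) =
      1 / (((x - c/2 : ℝ):ℂ) - (-(c/2) : ℝ) * I) - 1 / (((x - c/2 : ℝ):ℂ) - (c/2 : ℝ) * I) := by
    intro x
    congr 2 <;> simp only [hq, hp, ha] <;> push_cast <;> ring
  have hL1 := (aux_int_lor (c/2) (by positivity)).2
  have hL2 := (aux_int_lor (3*c/2) (by positivity)).2
  have hL3 : ∫ x : ℝ, (-(c/2)) / (x^2 + (-(c/2))^2) = -π := by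
    rw [← hL1, ← integral_neg]
    congr 1; funext x; rw [neg_sq, neg_div]
  have hR0i : Integrable (fun x : ℝ => 1 / ((x:ℂ) - p) - 1 / (x - q)) := by
    simp_rw [hR0e]
    exact (aux_ker_int (c/2) (3*c/2) (by positivity) (by positivity)).comp_sub_right (c/2)
  have hR1i : Integrable (fun x : ℝ => 1 / ((x:ℂ) + c * I - p) - 1 / (x + c * I - q)) := by
    simp_rw [hR1e]
    exact (aux_ker_int (-(c/2)) (c/2) (by simpa using hc0) (by positivity)).comp_sub_right (c/2)
  have hR0 : ∫ x : ℝ, (1 / ((x:ℂ) - p) - 1 / (x - q)) = 0 := by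
    simp_rw [hR0e]
    rw [integral_sub_right_eq_self (fun x : ℝ => 1 / ((x:ℂ) - (c/2 : ℝ) * I) -
      1 / ((x:ℂ) - (3*c/2 : ℝ) * I)), aux_ker _ _ (by positivity) (by positivity), hL1, hL2]
    simp
  have hR1 : ∫ x : ℝ, (1 / ((x:ℂ) + c * I - p) - 1 / (x + c * I - q)) = -2 * π * I := by
    simp_rw [hR1e]
    rw [integral_sub_right_eq_self (fun x : ℝ => 1 / ((x:ℂ) - (-(c/2) : ℝ) * I) -
      1 / ((x:ℂ) - (c/2 : ℝ) * I)), aux_ker _ _ (by simpa using hc0) (by positivity), hL1, hL3]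
    push_cast; ring
  have hne : ∀ v : ℂ, v.im ≠ c/2 → v ≠ p := by
    intro v h h2; rw [h2] at h; exact h hpim
  have hH0 : ∀ x : ℝ, H x = f x - r * (1 / ((x:ℂ) - p) - 1 / (x - q)) := by
    intro x
    apply hHf
    · simpa using hlin x 0 le_rfl hc.le
    · apply hne; simp; intro h; linarith
  have hH1 : ∀ x : ℝ, H (x + c * I) =
      f (x + c * I) - r * (1 / ((x:ℂ) + c * I - p) - 1 / (x + c * I - q)) := by
    intro x
    apply hHf
    · exact hlin x c hc.le le_rfl
    · apply hne; simp; intro h; linarith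
  set M : ℝ := Real.exp (2*π*c*|w|) with hM
  have hbd : ∀ (x y : ℝ), c < |x| → 0 ≤ y → y ≤ c → ‖H (x + y * I)‖ ≤
      M / (π * c * (|x| - c)) + ‖r‖ * (2 / (|x| - c)) := by
    intro x y hx h0 h1
    have hx0 : 0 < |x| - c := by linarith
    have hpx : |x| - c ≤ ‖(x:ℂ) + y * I - p‖ := by
      refine le_trans ?_ (Complex.abs_re_le_norm _)
      simp [hpre]
      have := abs_sub_abs_le_abs_sub x (c/2)
      rw [abs_of_pos (by positivity : 0 < c/2)] at this
      linarith
    have hqx : |x| - c ≤ ‖(x:ℂ) + y * I - q‖ := by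
      refine le_trans ?_ (Complex.abs_re_le_norm _)
      simp [hq, hpre]
      have := abs_sub_abs_le_abs_sub x (c/2)
      rw [abs_of_pos (by positivity : 0 < c/2)] at this
      linarith
    rw [hHf _ (hlin x y h0 h1) (by
      intro h
      rw [h, sub_self, norm_zero] at hpx
      linarith)]
    refine (norm_sub_le _ _).trans ?_
    rw [norm_mul r]
    have hE : ‖f (x + y * I)‖ ≤ M / (π * c * (|x| - c)) := by
      simp only [hf]
      rw [norm_mul, norm_inv, ← div_eq_mul_inv]
      apply div_le_div₀ (Real.exp_pos _).le
      · rw [Complex.norm_exp]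
        apply Real.exp_le_exp.mpr
        have : (-2 * π * I * (x + y * I) * w : ℂ) = ((2*π*y*w : ℝ) : ℂ) + ((-2*π*x*w : ℝ):ℂ) * I := by
          push_cast; linear_combination (-2*π*y*w) * Complex.I_sq
        rw [this]
        simp only [Complex.add_re, Complex.ofReal_re, Complex.re_ofReal_mul, Complex.I_re,
          mul_zero, add_zero]
        have : w ≤ |w| := le_abs_self w
        have h5 : y * w ≤ c * |w| := by
          calc y * w ≤ y * |w| := by gcongr
            _ ≤ c * |w| := by gcongr
        nlinarith [Real.pi_pos]
      · positivity
      · refine le_trans ?_ (aux_sinh_lb _)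
        have : (π * a * (x + y * I)) = ((π * c * (x - y) : ℝ) : ℂ) + ((π*c*(x+y) : ℝ) : ℂ) * I := by
          rw [ha]; push_cast; linear_combination (π*c*y) * Complex.I_sq
        rw [this]
        simp only [Complex.add_re, Complex.ofReal_re, Complex.re_ofReal_mul, Complex.I_re,
          mul_zero, add_zero]
        rw [abs_mul, abs_of_pos (by positivity : 0 < π * c)]
        gcongr
        have := abs_sub_abs_le_abs_sub x y
        rw [abs_of_nonneg h0] at this
        linarith
    refine add_le_add hE (mul_le_mul_of_nonneg_left ?_ (norm_nonneg _))
    refine (norm_sub_le _ _).trans ?_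
    rw [norm_div, norm_div, norm_one]
    have e1 : 1 / ‖(x:ℂ) + y * I - p‖ ≤ 1 / (|x| - c) := by gcongr
    have e2 : 1 / ‖(x:ℂ) + y * I - q‖ ≤ 1 / (|x| - c) := by gcongr
    calc _ ≤ 1 / (|x| - c) + 1 / (|x| - c) := add_le_add e1 e2
      _ = _ := by ring
  have main := aux_strip H c hc.le (by
      intro z h0 h1
      have hz : z ∈ S := ⟨by linarith, by linarith⟩
      apply DifferentiableAt.add (hkd2.differentiableAt (hSo.mem_nhds hz))
      apply DifferentiableAt.div (by fun_prop) (by fun_prop)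
      intro h
      have := sub_eq_zero.mp h
      rw [this, hqim] at h1
      linarith) (by
      simp_rw [hH0]; exact hf0.sub (hR0i.const_mul r)) (by
      simp_rw [hH1]; exact hf1.sub (hR1i.const_mul r))
    (fun T => M / (π * c * (T - c)) + ‖r‖ * (2 / (T - c))) (by
      have t : Filter.Tendsto (fun T : ℝ => T - c) Filter.atTop Filter.atTop :=
        Filter.tendsto_atTop_add_const_right _ _ Filter.tendsto_id
      have t1 := (t.const_mul_atTop (by positivity : 0 < π * c)).const_div_atTop M
      have t2 := (t.const_div_atTop 2).const_mul ‖r‖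
      simpa using t1.add t2) (by
      filter_upwards [Filter.eventually_gt_atTop c] with T hT y h0 h1
      have aT : |T| = T := abs_of_pos (by linarith)
      have b1 := hbd T y (by rw [aT]; exact hT) h0 h1
      have b2 := hbd (-T) y (by rw [abs_neg, aT]; exact hT) h0 h1
      rw [aT] at b1
      rw [abs_neg, aT] at b2
      push_cast at b2
      exact ⟨b1, b2⟩)
  simp_rw [hH0, hH1] at main
  rw [integral_sub hf0 (hR0i.const_mul r), integral_sub hf1 (hR1i.const_mul r),
    integral_const_mul, integral_const_mul, hR0, hR1, hJ1] at main
  change ∫ x : ℝ, f x = _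
  set J := ∫ x : ℝ, f x with hJ
  have hfin : J * (a * Complex.cosh (π * I * a * w)) = 1 := by
    have hz : cexp (-π*I*a*w) ≠ 0 := Complex.exp_ne_zero _
    have hz2 : cexp (-2*π*I*a*w) = cexp (-π*I*a*w)^2 := by
      rw [← Complex.exp_nat_mul]; congr 1; push_cast; ring
    rw [hz2, hrv] at main
    have hz3 : cexp (π * I * a * w) = (cexp (-π*I*a*w))⁻¹ := by
      rw [← Complex.exp_neg]; congr 1; ring
    have hI := Complex.I_ne_zero
    rw [Complex.cosh, hz3, show -(π * I * a * w) = -π*I*a*w by ring]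
    generalize cexp (-π*I*a*w) = E at *
    field_simp at main
    have m2 : J * a = E * (-(J * E * a) + 2) := by
      apply mul_left_cancel₀ (mul_ne_zero hpi hI)
      linear_combination main
    field_simp
    linear_combination m2
  exact eq_inv_of_mul_eq_one_left hfin

open scoped FourierTransform in
lemma aux_parseval (f g : ℝ → ℂ) (hf : Integrable f) (hg : Integrable g) :
    ∫ x : ℝ, 𝓕 f x * g x = ∫ x : ℝ, f x * 𝓕 g x := by
  simpa using! (VectorFourier.integral_fourierIntegral_smul_eq_flip (L := innerₗ ℝ)
      Real.continuous_fourierChar continuous_inner hf hg)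

lemma aux_c2 : (√2/2 : ℝ)^2 = 1/2 := by
  rw [div_pow, Real.sq_sqrt (by norm_num)]; norm_num

lemma aux_expq : Complex.exp ((π:ℂ) * I / 4) = ((√2/2 : ℝ):ℂ) * (1 + I) := by
  rw [show (π:ℂ) * I / 4 = ((π/4 : ℝ) : ℂ) * I by push_cast; ring, Complex.exp_mul_I,
    ← Complex.ofReal_cos, ← Complex.ofReal_sin, Real.cos_pi_div_four, Real.sin_pi_div_four]
  ring

lemma aux_om : Complex.exp (3 * (π:ℂ) * I / 4) = I * (((√2/2 : ℝ):ℂ) * (1 + I)) := by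
  rw [← aux_expq, show 3 * (π:ℂ) * I / 4 = π/2 * I + π * I / 4 by ring, Complex.exp_add,
    Complex.exp_pi_div_two_mul_I]

lemma aux_a2 : (((√2/2 : ℝ):ℂ) * (1 + I))^2 = I := by
  have hcc : ((√2/2 : ℝ):ℂ)^2 = 1/2 := by rw [← Complex.ofReal_pow, aux_c2]; simp
  linear_combination (1+I)^2 * hcc + 1/2 * Complex.I_sq

lemma aux_U (u τ a : ℂ) (ha : a = ((√2/2 : ℝ):ℂ) * (1 + I)) :
    Upsilon u τ = -(I * a / 2) * cexp (-π*I*τ/4 + π*I*u) *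
      ∫ v : ℝ, cexp (-π*τ*v^2 + 2*π*(a*(τ - 2*u + 1)/2)*v) * (Complex.cosh (π * a * v))⁻¹ := by
  unfold Upsilon
  have ha2 : a^2 = I := by rw [ha]; exact aux_a2
  rw [aux_om, ← ha, ← integral_const_mul]
  congr 1
  funext v
  have e1 : cexp (2 * π * I * (1/2 + I * a * v)) - 1 =
      -(2 * cexp (-π*a*v) * Complex.cosh (π*a*v)) := by
    rw [Complex.cosh, show 2 * (π:ℂ) * I * (1/2 + I * a * v) = π * I + (-π*a*v + -π*a*v) by
      linear_combination (2*π*a*v)*Complex.I_sq, Complex.exp_add, Complex.exp_add,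
      Complex.exp_pi_mul_I, show -(π*a*v) = -π*a*v by ring]
    have : cexp (-π*a*v) * cexp (π*a*v) = 1 := by
      rw [← Complex.exp_add]; simp
    linear_combination this
  have e2 : cexp (-π * I * τ * (1/2 + I * a * v)^2 + 2 * π * I * u * (1/2 + I*a*v)) =
      cexp (-π*I*τ/4 + π*I*u) * cexp (-π*τ*v^2 + 2*π*(a*(τ - 2*u + 1)/2)*v) * cexp (-π*a*v) := by
    rw [← Complex.exp_add, ← Complex.exp_add]
    congr 1
    linear_combination (-π*I*τ*I^2*v^2) * ha2 + (-π*τ*a*v + 2*π*u*a*v - π*τ*v^2*(I^2 - 1)) * Complex.I_sq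
  rw [e1, e2]
  have := Complex.exp_ne_zero (-π*a*v)
  generalize cexp (-π*a*v) = E at *
  have e3 : E * E⁻¹ = 1 := mul_inv_cancel₀ this
  rw [div_neg, div_eq_mul_inv, mul_inv, mul_inv]
  generalize (Complex.cosh (π * a * v))⁻¹ = K at *
  generalize E⁻¹ = E' at *
  generalize cexp (-π*I*τ/4 + π*I*u) = E1 at *
  generalize cexp (-π*τ*v^2 + 2*π*(a*(τ - 2*u + 1)/2)*v) = E2 at *
  linear_combination (-(I * a * E1 * E2 * K / 2)) * e3

lemma aux_conj_a (a : ℂ) (ha : a = ((√2/2 : ℝ):ℂ) * (1 + I)) : starRingEnd ℂ a = -I * a := by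
  rw [ha]
  simp only [map_mul, Complex.conj_ofReal, map_add, map_one, Complex.conj_I]
  linear_combination (((√2/2 : ℝ):ℂ)) * Complex.I_sq

lemma aux_conjU (u τ a : ℂ) (ha : a = ((√2/2 : ℝ):ℂ) * (1 + I)) :
    starRingEnd ℂ (Upsilon (starRingEnd ℂ u) (starRingEnd ℂ τ)) =
      a / 2 * cexp (π*I*τ/4 - π*I*u) *
      ∫ v : ℝ, cexp (-π*τ*v^2 + 2*π*(-I*a*(τ - 2*u + 1)/2)*v) *
        (Complex.cosh (π * I * a * v))⁻¹ := by
  rw [aux_U _ _ a ha, map_mul, ← integral_conj]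
  have hca := aux_conj_a a ha
  congr 1
  · rw [map_mul, ← Complex.exp_conj]
    simp only [map_mul, map_add, map_neg, map_div₀, Complex.conj_conj, Complex.conj_I,
      Complex.conj_ofReal, hca, map_ofNat]
    congr 1
    · linear_combination (-a/2) * Complex.I_sq
    · congr 1; ring
  · congr 1
    funext v
    rw [map_mul, ← Complex.exp_conj, map_inv₀, ← Complex.cosh_conj]
    simp only [map_mul, map_add, map_sub, map_neg, map_div₀, Complex.conj_conj, Complex.conj_I,
      Complex.conj_ofReal, hca, map_ofNat, map_pow, map_one]
    congr 2
    rw [← Complex.cosh_neg]; congr 1; ring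

lemma aux_i (u τ : ℂ) (hτ : 0 < τ.re) :
    Upsilon (u/τ) (1/τ) = τ ^ ((1:ℂ)/2) * Complex.exp ((π:ℂ)*I*(u^2/τ - 1/4)) *
        starRingEnd ℂ (Upsilon (starRingEnd ℂ u) (starRingEnd ℂ τ)) := by
  obtain ⟨a, ha⟩ : ∃ a : ℂ, a = ((√2/2 : ℝ):ℂ) * (1 + I) := ⟨_, rfl⟩
  have ha2 : a^2 = I := by rw [ha]; exact aux_a2
  have ha0 : a ≠ 0 := by
    intro h; rw [h] at ha2; simp at ha2; exact Complex.I_ne_zero ha2.symm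
  have hτ0 : τ ≠ 0 := by intro h; rw [h] at hτ; simp at hτ
  have hs0 : τ ^ ((1:ℂ)/2) ≠ 0 := by simp [Complex.cpow_eq_zero_iff, hτ0]
  obtain ⟨m, hm⟩ : ∃ m : ℂ, m = τ - 2*u + 1 := ⟨_, rfl⟩
  have hc : 0 < √2/2 := by positivity
  set F : ℝ → ℂ := fun v => (Complex.cosh (π * a * v))⁻¹ with hF
  have hFi : Integrable F := by
    simp only [hF, ha]; exact aux_F_int _ hc
  have hFF : ∀ w : ℝ, FourierTransform.fourier F w = (a * Complex.cosh (π * I * a * w))⁻¹ := by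
    intro w
    rw [ha, ← aux_FT _ hc aux_c2 w, Real.fourier_real_eq_integral_exp_smul]
    congr 1; funext v
    simp only [hF, ha, smul_eq_mul]
    congr 2; push_cast; ring
  set g : ℝ → ℂ := fun v => cexp (-π*τ*v^2 + 2*π*(-I*a*m/2)*v) with hg
  have hgi : Integrable g := by
    have h := integrable_cexp_quadratic (b := π*τ) (by simp; positivity) (2*π*(-I*a*m/2)) 0
    simpa [hg] using h
  have hgF : FourierTransform.fourier g = fun t : ℝ => 1 / τ ^ ((1:ℂ)/2) *
      cexp (-π/τ * (t + I * (-I*a*m/2))^2) := fourier_gaussian_pi' hτ _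
  have hP := aux_parseval F g hFi hgi
  rw [hgF] at hP
  simp_rw [hFF] at hP
  set X : ℂ := ∫ v : ℝ, F v * cexp (-π/τ * (v + a*m/2)^2) with hX
  have h1 : starRingEnd ℂ (Upsilon (starRingEnd ℂ u) (starRingEnd ℂ τ)) =
      I / 2 * cexp (π*I*τ/4 - π*I*u) * ((τ ^ ((1:ℂ)/2))⁻¹ * X) := by
    have h2 : (τ ^ ((1:ℂ)/2))⁻¹ * X = ∫ x : ℝ, (a * Complex.cosh (π * I * a * x))⁻¹ * g x := by
      rw [hP, hX, ← integral_const_mul]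
      congr 1; funext v
      rw [show I * (-I*a*m/2) = a*m/2 by linear_combination (-a*m/2) * Complex.I_sq]
      ring
    rw [aux_conjU u τ a ha, h2, ← hm]
    have h3 : ∫ x : ℝ, (a * Complex.cosh (π * I * a * x))⁻¹ * g x =
        a⁻¹ * ∫ v : ℝ, cexp (-π*τ*v^2 + 2*π*(-I*a*m/2)*v) * (Complex.cosh (π * I * a * v))⁻¹ := by
      rw [← integral_const_mul]
      congr 1; funext v
      rw [mul_inv, hg]; ring
    rw [h3, ← ha2]
    field_simp
  have h4 : Upsilon (u/τ) (1/τ) = -(I * a / 2) * cexp (-π*I*(1/τ)/4 + π*I*(u/τ)) *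
      (cexp (π*I*m^2/(4*τ)) * X) := by
    rw [aux_U _ _ a ha, hX]
    congr 1
    rw [← integral_const_mul, ← integral_neg_eq_self]
    congr 1; funext v
    have : F (-v) = F v := by
      simp only [hF]; rw [← Complex.cosh_neg]; congr 2; push_cast; ring
    change _ * F (-v) = _
    rw [this, mul_comm (F v), ← mul_assoc, ← Complex.exp_add]
    congr 2
    rw [hm]; push_cast; field_simp
    linear_combination (4*(τ-2*u+1)^2) * ha2
  rw [h4, h1]
  have h5 : cexp (-π*I*(1/τ)/4 + π*I*(u/τ)) * cexp (π*I*m^2/(4*τ)) * (-I) =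
      cexp ((π:ℂ)*I*(u^2/τ - 1/4)) * cexp (π*I*τ/4 - π*I*u) * cexp (π*I/4) := by
    have : -I = cexp (-(π/2) * I) := by
      rw [neg_mul, Complex.exp_neg, Complex.exp_pi_div_two_mul_I, Complex.inv_I]
    rw [this, ← Complex.exp_add, ← Complex.exp_add, ← Complex.exp_add, ← Complex.exp_add]
    congr 1
    rw [hm]; field_simp; ring
  rw [aux_expq, ← ha] at h5
  generalize cexp (-π*I*(1/τ)/4 + π*I*(u/τ)) = E1 at *
  generalize cexp (π*I*m^2/(4*τ)) = E2 at *
  generalize cexp ((π:ℂ)*I*(u^2/τ - 1/4)) = E3 at *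
  generalize cexp (π*I*τ/4 - π*I*u) = E4 at *
  have hs := mul_inv_cancel₀ hs0
  linear_combination (a*X/2)*h5 + E3*E4*X/2*ha2 - (E3*E4*I/2*X)*hs

lemma aux_ii (u τ : ℂ) (hτ : 0 < τ.re) :
    G u (1/τ) = starRingEnd ℂ (G (starRingEnd ℂ u) (starRingEnd ℂ τ)) := by
  have hτ0 : τ ≠ 0 := by intro h; rw [h] at hτ; simp at hτ
  have harg : τ.arg ≠ π := by
    intro h
    rw [Complex.arg_eq_pi_iff] at h
    linarith [h.1]
  have hs2 : τ ^ ((1:ℂ)/2) = (τ ^ ((1:ℂ)/4))^2 := by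
    rw [← Complex.cpow_nat_mul]; congr 1; norm_num
  have ht : (τ ^ ((1:ℂ)/4))^4 = τ := by
    rw [← Complex.cpow_nat_mul]; norm_num
  have ht0 : τ ^ ((1:ℂ)/4) ≠ 0 := by simp [Complex.cpow_eq_zero_iff, hτ0]
  have c4 : starRingEnd ℂ (starRingEnd ℂ τ ^ ((1:ℂ)/4)) = τ ^ ((1:ℂ)/4) := by
    rw [← Complex.cpow_conj _ _ harg]; simp only [map_div₀, map_one, map_ofNat]
  have c2 : starRingEnd ℂ τ ^ ((1:ℂ)/2) = starRingEnd ℂ (τ ^ ((1:ℂ)/2)) := by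
    rw [Complex.conj_cpow _ _ harg]; simp only [map_div₀, map_one, map_ofNat]
  unfold G
  rw [map_mul, map_mul, c4, c2, ← Complex.exp_conj, ← map_mul]
  have e0 : (1/τ) ^ ((1:ℂ)/2) * u = (τ ^ ((1:ℂ)/2) * u) / τ := by
    rw [one_div, Complex.inv_cpow _ _ harg, hs2]
    conv_rhs => rw [← ht]
    rw [ht]
    field_simp
    linear_combination (-u) * ht
  rw [e0, aux_i _ _ hτ, one_div τ, Complex.inv_cpow _ _ harg, hs2]
  have e1 : (((τ ^ ((1:ℂ)/4))^2 * u)^2 / τ) = u^2 := by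
    field_simp
    linear_combination u^2 * ht
  rw [e1]
  have e2 : cexp (-π * I * u^2/2 + π * I / 8) * cexp (π * I * (u^2 - 1/4)) =
      cexp (starRingEnd ℂ (-π * I * (starRingEnd ℂ u)^2/2 + π * I / 8)) := by
    rw [← Complex.exp_add]
    simp only [map_mul, map_add, map_sub, map_neg, map_div₀, Complex.conj_conj, Complex.conj_I,
      Complex.conj_ofReal, map_ofNat, map_pow]
    congr 1; ring
  rw [← e2]
  field_simp

theorem statement8 (u τ : ℂ) (hτ : 0 < τ.re) :
    Upsilon (u/τ) (1/τ) = τ ^ ((1:ℂ)/2) * Complex.exp ((π:ℂ)*I*(u^2/τ - 1/4)) *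
        starRingEnd ℂ (Upsilon (starRingEnd ℂ u) (starRingEnd ℂ τ)) ∧
    G u (1/τ) = starRingEnd ℂ (G (starRingEnd ℂ u) (starRingEnd ℂ τ)) ∧
    ∀ k : ℕ, Gderiv k u (1/τ) =
      starRingEnd ℂ (Gderiv k (starRingEnd ℂ u) (starRingEnd ℂ τ)) := by
  refine ⟨aux_i u τ hτ, aux_ii u τ hτ, ?_⟩
  intro k
  unfold Gderiv
  have h0 : (fun w => G w (1/τ)) =
      starRingEnd ℂ ∘ (fun w => G w (starRingEnd ℂ τ)) ∘ starRingEnd ℂ := by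
    funext w; exact aux_ii w τ hτ
  have h : ∀ (k : ℕ) (f : ℂ → ℂ), iteratedDeriv k (starRingEnd ℂ ∘ f ∘ starRingEnd ℂ) =
      starRingEnd ℂ ∘ iteratedDeriv k f ∘ starRingEnd ℂ := by
    intro k f
    induction k with
    | zero => simp
    | succ n ih => rw [iteratedDeriv_succ, iteratedDeriv_succ, ih, deriv_conj_conj]
  rw [h0, h]; rfl

end
end
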